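/- Geometric form of Proposition 5.4 for E₈: For every sign function ε on the seven edges (1,2), (2,4), (3,4), (4,5), (5,6), (6,7), (7,8) of the E₈ diagram with values in {+1, −1}, there exists a stable 30-gon of type E8 with the following properties (after cyclic relabeling of indices): V₁, V₂, V₃, V₄, V₅ are smaller, in the order on ℂ, than all other points of {V_j} ∪ {W_j}; W₁ ≠ W₄, and letting △₊ = {V₀, W₁, W₃} if W₁ < W₄ and △₊ = {W₂, W₄, V₆} if W₄ < W₁, the eight points {V₁, …, V₅} ∪ △₊ are pairwise distinct and form a positively convex octagon in a suitable cyclic order; listing these eight points increasingly as P₁ < P₂ < ⋯ < P₈ and setting s₁ := P₂ − P₁, s₂ := P₃ − P₂, s₄ := P₄ − P₃, s₅ := P₅ − P₄, s₆ := P₆ − P₅, s₇ := P₇ − P₆, s₈ := P₈ − P₇, and s₃ := W₂ − V₀ if V₀ < W₂ and s₃ := V₀ − W₂ otherwise, then for each edge (a,b) among the seven edges above, the number Im( conj(s_a) · s_b ) is nonzero with sign ε(a,b). -/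

import Mathlib

noncomputable section

/-- The (strict) total order on `ℂ`: compare imaginary parts first, then real parts. -/
def cLt (a b : ℂ) : Prop := a.im < b.im ∨ (a.im = b.im ∧ a.re < b.re)

/-- The corresponding non-strict order on `ℂ`. -/
def cLe (a b : ℂ) : Prop := cLt a b ∨ a = b

/-- `cross u v = Im (conj u * v)`. -/
def cross (u v : ℂ) : ℝ := ((starRingEnd ℂ) u * v).im

/-- A positively convex `h`-gon: every other vertex lies strictly to the left of each
directed edge from `V (j-1)` to `V j`. -/
def PosConvex {h : ℕ} (V : ZMod h → ℂ) : Prop :=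
  ∀ j i : ZMod h, i ≠ j - 1 → i ≠ j →
    0 < cross (V j - V (j - 1)) (V i - V (j - 1))

/-- The (open) level-`s` diagonal-gon of an `h`-gon. -/
def DiagGon {h : ℕ} (V : ZMod h → ℂ) (s : ℕ) : Set ℂ :=
  {P : ℂ | ∀ j : ZMod h, 0 < cross (V (j + (s : ZMod h)) - V j) (P - V j)}

/-- Edge vectors of an `h`-gon. -/
def zEdge {h : ℕ} (V : ZMod h → ℂ) (j : ZMod h) : ℂ := V j - V (j - 1)

/-- A 30-gon of type E8. -/
def IsE8Gon (V : ZMod 30 → ℂ) : Prop :=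
  (∀ j : ZMod 30, V (j + 15) = -V j) ∧
  (∀ j : ZMod 30, zEdge V j + zEdge V (j + 10) + zEdge V (j + 20) = 0) ∧
  (∀ j : ZMod 30,
    zEdge V j + zEdge V (j + 6) + zEdge V (j + 12) + zEdge V (j + 18) + zEdge V (j + 24) = 0)

/-- The inner points `W j` of a 30-gon of type E8. -/
def WE8 (V : ZMod 30 → ℂ) (j : ZMod 30) : ℂ := V (j + 1) + zEdge V (j + 11)

/-- A stable 30-gon of type E8. -/
def IsStableE8Gon (V : ZMod 30 → ℂ) : Prop :=
  IsE8Gon V ∧ PosConvex V ∧ ∀ j : ZMod 30, WE8 V j ∈ DiagGon V 5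

/-! ### An integer checker -/

abbrev Pt := ℕ × ℕ

def ori (a b c : Pt) : Bool :=
  Nat.blt (Nat.add (Nat.add (Nat.mul a.2 b.1) (Nat.mul b.2 c.1)) (Nat.mul c.2 a.1))
    (Nat.add (Nat.add (Nat.mul a.1 b.2) (Nat.mul b.1 c.2)) (Nat.mul c.1 a.2))

def crs (a b p q : Pt) : Bool :=
  Nat.blt (b.1 * p.2 + a.1 * q.2 + b.2 * q.1 + a.2 * p.1)
    (b.1 * q.2 + a.1 * p.2 + b.2 * p.1 + a.2 * q.1)

def at' (l : List Pt) (k : ℕ) : Pt := l.getD k (0, 0)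

def neg' (p : Pt) : Pt := (Nat.sub 400 p.1, Nat.sub 400 p.2)

def full (l : List Pt) : List Pt := l ++ l.map neg'

def walk (f : List Pt → Bool) : ℕ → List Pt → Bool
  | 0, _ => true
  | n + 1, l => f l && walk f n l.tail

def convAt (m : ℕ) (l : List Pt) : Bool :=
  ((l.drop 2).take m).all (ori (at' l 0) (at' l 1))

def diagAt (ws : List Pt) (l : List Pt) : Bool := ws.all (ori (at' l 0) (at' l 5))

def relAt (l : List Pt) : Bool :=
  Nat.beq ((at' l 0).1 + (at' l 15).1) 400 && Nat.beq ((at' l 0).2 + (at' l 15).2) 400 &&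
  (Nat.beq ((at' l 0).1 + (at' l 10).1 + (at' l 20).1) 600 &&
    Nat.beq ((at' l 0).2 + (at' l 10).2 + (at' l 20).2) 600) &&
  (Nat.beq ((at' l 0).1 + (at' l 6).1 + (at' l 12).1 + (at' l 18).1 + (at' l 24).1) 1000 &&
    Nat.beq ((at' l 0).2 + (at' l 6).2 + (at' l 12).2 + (at' l 18).2 + (at' l 24).2) 1000)

def chkW : List Pt → List Pt → Bool
  | [], _ => true
  | w :: t, l => (Nat.beq (w.1 + (at' l 10).1) ((at' l 1).1 + (at' l 11).1) &&
      Nat.beq (w.2 + (at' l 10).2) ((at' l 1).2 + (at' l 11).2)) && chkW t l.tail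

def lowAt (us : List Pt) (v : Pt) : Bool := us.all (fun u => Nat.blt v.2 u.2)

def octo (tt : Bool) (v w : List Pt) : List Pt :=
  [at' v 1, at' v 2, at' v 3, at' v 4, at' v 5] ++
    bif tt then [at' v 6, at' w 4, at' w 2] else [at' w 3, at' w 1, at' v 0]

abbrev Dat := Bool × List ℕ × List Pt × List Pt

def pp (o : List Pt) (ps : List ℕ) (k : ℕ) : Pt := at' o (ps.getD k 0)

def sgn (e : Bool) (a b c : Pt) : Bool := bif e then ori a b c else ori a c b

def chkO (b1 b2 b3 b4 b5 b6 b7 : Bool) (tt : Bool) (ps : List ℕ) (v0 w2 : Pt) (o : List Pt) : Bool :=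
  Nat.beq o.length 8 && Nat.beq ps.length 8 && ps.all (fun k => Nat.blt k 8) &&
  walk (convAt 6) 8 (o ++ o) &&
  (Nat.blt (pp o ps 0).2 (pp o ps 1).2 && Nat.blt (pp o ps 1).2 (pp o ps 2).2 &&
   Nat.blt (pp o ps 2).2 (pp o ps 3).2 && Nat.blt (pp o ps 3).2 (pp o ps 4).2 &&
   Nat.blt (pp o ps 4).2 (pp o ps 5).2 && Nat.blt (pp o ps 5).2 (pp o ps 6).2 &&
   Nat.blt (pp o ps 6).2 (pp o ps 7).2) &&
  (sgn b1 (pp o ps 0) (pp o ps 1) (pp o ps 2) && sgn b2 (pp o ps 1) (pp o ps 2) (pp o ps 3) &&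
   sgn b4 (pp o ps 2) (pp o ps 3) (pp o ps 4) && sgn b5 (pp o ps 3) (pp o ps 4) (pp o ps 5) &&
   sgn b6 (pp o ps 4) (pp o ps 5) (pp o ps 6) && sgn b7 (pp o ps 5) (pp o ps 6) (pp o ps 7)) &&
  (bif (xor b3 tt) then crs v0 w2 (pp o ps 2) (pp o ps 3)
    else crs w2 v0 (pp o ps 2) (pp o ps 3))

def chkV (tt : Bool) (v w : List Pt) : Bool :=
  Nat.beq v.length 30 && Nat.beq w.length 30 &&
  walk (convAt 28) 15 (v ++ v) &&
  walk (diagAt w) 15 (v ++ v) &&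
  walk relAt 30 (v ++ v) &&
  chkW w (v ++ v) &&
  ((v.drop 1).take 5).all (fun p => lowAt w p && lowAt (((v ++ v).drop 6).take 25) p) &&
  (bif tt then Nat.blt (at' w 4).2 (at' w 1).2 && Nat.blt (at' w 2).2 (at' v 0).2
    else Nat.blt (at' w 1).2 (at' w 4).2 && Nat.blt (at' v 0).2 (at' w 2).2)

def chk (b1 b2 b3 b4 b5 b6 b7 : Bool) (d : Dat) : Bool :=
  chkV d.1 (full d.2.2.1) (full d.2.2.2) &&
  chkO b1 b2 b3 b4 b5 b6 b7 d.1 d.2.1 (at' d.2.2.1 0) (at' d.2.2.2 2)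
    (octo d.1 d.2.2.1 d.2.2.2)

def chkAll : ℕ → List Dat → Bool
  | _, [] => true
  | n, d :: t => chk (n.testBit 0) (n.testBit 1) (n.testBit 2) (n.testBit 3) (n.testBit 4)
      (n.testBit 5) (n.testBit 6) d && chkAll (n + 1) t

def tab0 : List Dat :=
  [(true, [4, 3, 2, 1, 0, 7, 6, 5],
   [(123, 112), (152, 102), (169, 97), (186, 95), (210, 93), (235, 92), (259, 114), (272, 126), (284, 140), (299, 160), (312, 180), (307, 212), (303, 229), (298, 245), (289, 267)],
   [(147, 134), (165, 114), (181, 111), (201, 115), (223, 113), (230, 124), (255, 131), (267, 142), (275, 162), (287, 181), (283, 190), (290, 217), (286, 231), (274, 247), (264, 268)]),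
  (true, [3, 4, 2, 1, 0, 7, 6, 5],
   [(133, 124), (157, 116), (173, 111), (188, 108), (210, 106), (229, 107), (251, 125), (263, 135), (274, 146), (286, 165), (296, 183), (294, 209), (290, 224), (286, 238), (276, 259)],
   [(155, 142), (169, 126), (184, 122), (200, 127), (220, 124), (227, 133), (247, 140), (259, 149), (264, 167), (277, 182), (272, 191), (278, 214), (275, 227), (264, 240), (257, 258)]),
  (true, [3, 2, 4, 1, 0, 7, 6, 5],
   [(132, 120), (154, 112), (172, 107), (191, 103), (213, 100), (229, 105), (254, 122), (267, 132), (280, 144), (290, 164), (297, 185), (300, 210), (295, 225), (289, 241), (277, 264)],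
   [(157, 137), (167, 122), (185, 119), (201, 123), (220, 121), (232, 130), (249, 137), (261, 148), (268, 167), (281, 180), (275, 193), (282, 215), (276, 229), (267, 244), (261, 259)]),
  (true, [2, 3, 4, 1, 0, 7, 6, 5],
   [(124, 110), (149, 100), (166, 95), (191, 89), (215, 90), (233, 93), (260, 112), (275, 124), (291, 138), (302, 162), (309, 183), (311, 212), (309, 229), (300, 249), (287, 272)],
   [(151, 129), (164, 112), (182, 109), (202, 113), (222, 111), (235, 122), (258, 129), (266, 144), (278, 161), (291, 180), (284, 193), (294, 217), (284, 235), (276, 248), (269, 269)]),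
  (false, [4, 3, 2, 1, 0, 7, 6, 5],
   [(127, 113), (157, 104), (172, 101), (190, 99), (212, 97), (236, 96), (260, 119), (271, 130), (283, 145), (296, 162), (309, 183), (303, 215), (299, 229), (293, 246), (284, 265)],
   [(151, 136), (168, 115), (184, 116), (203, 116), (225, 118), (230, 128), (256, 133), (265, 147), (274, 164), (285, 184), (279, 192), (288, 218), (281, 231), (271, 248), (260, 266)]),
  (false, [3, 4, 2, 1, 0, 7, 6, 5],
   [(124, 110), (154, 101), (169, 98), (189, 95), (213, 92), (235, 93), (261, 116), (273, 127), (286, 142), (300, 160), (311, 183), (307, 215), (304, 229), (297, 247), (287, 268)],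
   [(150, 133), (166, 112), (182, 113), (203, 113), (224, 115), (231, 125), (258, 130), (266, 145), (276, 163), (289, 182), (281, 192), (292, 218), (284, 232), (273, 250), (265, 267)]),
  (false, [3, 2, 4, 1, 0, 7, 6, 5],
   [(161, 152), (174, 148), (183, 146), (195, 144), (208, 142), (218, 145), (232, 156), (239, 162), (247, 169), (254, 180), (257, 193), (258, 208), (256, 216), (252, 225), (246, 238)],
   [(175, 163), (181, 154), (191, 153), (202, 155), (211, 155), (219, 160), (230, 164), (235, 171), (241, 182), (247, 190), (244, 197), (249, 210), (244, 218), (239, 227), (236, 235)]),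
  (false, [2, 3, 4, 1, 0, 7, 6, 5],
   [(135, 120), (157, 112), (171, 108), (193, 104), (213, 105), (230, 107), (253, 125), (265, 135), (279, 149), (289, 168), (295, 187), (296, 213), (294, 227), (286, 245), (276, 263)],
   [(158, 138), (169, 122), (185, 122), (203, 123), (219, 124), (231, 133), (251, 139), (257, 153), (269, 167), (278, 185), (273, 195), (282, 217), (272, 231), (266, 244), (259, 261)]),
  (false, [3, 2, 1, 4, 0, 7, 6, 5],
   [(158, 148), (172, 144), (183, 141), (196, 139), (209, 138), (219, 142), (235, 153), (243, 159), (251, 168), (257, 180), (261, 194), (263, 209), (260, 218), (255, 229), (248, 242)],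
   [(174, 159), (180, 150), (191, 150), (202, 151), (213, 152), (221, 157), (232, 162), (238, 170), (244, 181), (251, 190), (247, 198), (252, 212), (247, 220), (242, 230), (238, 238)]),
  (false, [2, 3, 1, 4, 0, 7, 6, 5],
   [(164, 155), (175, 151), (184, 148), (197, 146), (207, 147), (217, 150), (230, 159), (237, 164), (245, 173), (250, 184), (253, 195), (255, 208), (253, 216), (248, 227), (243, 237)],
   [(177, 164), (182, 156), (192, 157), (202, 157), (210, 158), (219, 163), (228, 167), (232, 175), (240, 183), (243, 192), (242, 199), (246, 211), (240, 218), (238, 226), (233, 234)]),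
  (false, [2, 1, 3, 4, 0, 7, 6, 5],
   [(129, 105), (152, 97), (168, 93), (191, 92), (216, 94), (237, 96), (261, 118), (274, 131), (289, 149), (305, 169), (308, 191), (309, 221), (306, 238), (298, 257), (289, 275)],
   [(153, 127), (165, 110), (183, 111), (207, 112), (219, 116), (238, 126), (258, 135), (266, 150), (280, 167), (287, 189), (285, 199), (293, 225), (283, 239), (273, 255), (268, 273)]),
  (false, [1, 2, 3, 4, 0, 7, 6, 5],
   [(143, 123), (160, 116), (174, 111), (194, 112), (212, 113), (231, 115), (250, 132), (260, 142), (274, 159), (285, 174), (288, 192), (290, 216), (286, 231), (280, 247), (273, 261)],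
   [(162, 140), (170, 126), (188, 128), (205, 127), (215, 131), (233, 139), (246, 147), (254, 158), (267, 173), (269, 190), (271, 199), (276, 221), (266, 230), (262, 246), (254, 259)]),
  (false, [3, 2, 1, 4, 0, 7, 6, 5],
   [(157, 147), (170, 142), (182, 139), (195, 137), (209, 136), (219, 141), (235, 151), (244, 158), (252, 167), (259, 180), (262, 194), (265, 209), (262, 219), (257, 230), (250, 244)],
   [(173, 157), (179, 149), (190, 148), (202, 150), (212, 150), (222, 156), (232, 161), (239, 169), (245, 181), (252, 189), (249, 199), (253, 212), (249, 221), (243, 231), (240, 239)]),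
  (false, [2, 3, 1, 4, 0, 7, 6, 5],
   [(153, 141), (167, 136), (180, 132), (196, 129), (209, 131), (221, 135), (239, 146), (248, 154), (258, 164), (264, 180), (268, 194), (272, 210), (268, 222), (262, 235), (255, 249)],
   [(171, 152), (176, 144), (190, 142), (202, 145), (213, 145), (225, 151), (235, 158), (242, 167), (251, 178), (256, 190), (254, 199), (259, 214), (252, 225), (249, 233), (243, 245)]),
  (false, [2, 1, 3, 4, 0, 7, 6, 5],
   [(155, 144), (168, 139), (182, 134), (196, 133), (209, 135), (220, 138), (237, 149), (247, 156), (255, 167), (261, 182), (265, 194), (269, 210), (265, 222), (259, 234), (252, 247)],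
   [(172, 155), (178, 146), (190, 145), (202, 148), (213, 147), (224, 154), (233, 161), (241, 168), (248, 180), (254, 191), (252, 199), (255, 215), (251, 223), (246, 232), (241, 244)]),
  (false, [1, 2, 3, 4, 0, 7, 6, 5],
   [(145, 132), (160, 125), (178, 118), (195, 119), (211, 121), (225, 124), (245, 137), (258, 146), (268, 161), (275, 178), (280, 192), (285, 212), (280, 228), (273, 242), (264, 257)],
   [(165, 145), (173, 134), (188, 133), (202, 136), (216, 135), (230, 144), (240, 153), (251, 160), (259, 176), (266, 189), (265, 199), (267, 219), (263, 227), (257, 240), (250, 254)])]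

def tab1 : List Dat :=
  [(true, [3, 2, 1, 0, 4, 7, 6, 5],
   [(171, 165), (179, 161), (188, 159), (194, 158), (204, 157), (214, 162), (221, 167), (229, 173), (233, 178), (239, 188), (243, 197), (242, 206), (241, 214), (239, 220), (235, 231)],
   [(178, 170), (187, 167), (192, 164), (200, 168), (208, 166), (213, 171), (220, 175), (227, 179), (229, 189), (233, 192), (235, 201), (233, 208), (235, 215), (229, 221), (225, 226)]),
  (true, [2, 3, 1, 0, 4, 7, 6, 5],
   [(158, 148), (170, 143), (181, 139), (193, 136), (207, 138), (220, 145), (232, 152), (242, 160), (250, 168), (258, 185), (262, 197), (262, 209), (261, 221), (257, 232), (251, 247)],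
   [(170, 155), (180, 151), (189, 147), (201, 153), (211, 150), (220, 157), (231, 164), (238, 171), (244, 183), (249, 190), (250, 202), (251, 213), (249, 224), (243, 230), (238, 240)]),
  (true, [2, 1, 3, 0, 4, 7, 6, 5],
   [(165, 157), (176, 152), (186, 148), (195, 147), (207, 150), (217, 154), (229, 160), (236, 167), (242, 175), (249, 189), (252, 197), (253, 208), (250, 219), (247, 228), (242, 239)],
   [(177, 163), (183, 159), (192, 156), (202, 161), (210, 158), (218, 165), (226, 171), (233, 176), (237, 186), (242, 193), (241, 202), (243, 212), (241, 220), (235, 225), (232, 235)]),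
  (true, [1, 2, 3, 0, 4, 7, 6, 5],
   [(161, 152), (171, 146), (183, 140), (195, 141), (209, 144), (218, 148), (230, 154), (242, 162), (248, 173), (255, 187), (257, 196), (259, 208), (259, 222), (253, 232), (246, 243)],
   [(173, 158), (183, 154), (189, 151), (202, 155), (211, 153), (220, 160), (230, 168), (236, 172), (241, 184), (248, 192), (247, 202), (247, 214), (247, 221), (239, 229), (237, 239)]),
  (false, [3, 2, 1, 0, 4, 7, 6, 5],
   [(169, 159), (178, 156), (185, 154), (194, 152), (206, 151), (216, 157), (225, 164), (231, 169), (238, 176), (246, 186), (247, 198), (247, 208), (246, 215), (244, 224), (240, 235)],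
   [(178, 166), (184, 161), (192, 161), (202, 162), (207, 163), (216, 167), (224, 171), (229, 178), (234, 187), (237, 192), (238, 201), (240, 210), (237, 217), (232, 225), (230, 229)]),
  (false, [2, 3, 1, 0, 4, 7, 6, 5],
   [(164, 153), (173, 149), (183, 146), (197, 143), (207, 144), (219, 151), (230, 158), (238, 164), (248, 172), (252, 186), (255, 198), (257, 209), (255, 218), (251, 229), (245, 242)],
   [(175, 160), (181, 155), (193, 154), (201, 157), (210, 156), (221, 162), (228, 167), (234, 175), (242, 185), (243, 191), (246, 202), (247, 212), (241, 221), (241, 228), (233, 235)]),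
  (false, [2, 1, 3, 0, 4, 7, 6, 5],
   [(165, 156), (175, 152), (186, 149), (196, 147), (207, 150), (216, 154), (228, 161), (237, 167), (242, 176), (248, 188), (251, 198), (253, 209), (251, 218), (246, 229), (241, 238)],
   [(177, 163), (184, 158), (191, 158), (202, 159), (210, 160), (218, 165), (226, 170), (232, 178), (237, 185), (242, 194), (241, 202), (242, 212), (241, 220), (235, 226), (232, 234)]),
  (false, [1, 2, 3, 0, 4, 7, 6, 5],
   [(174, 166), (180, 163), (189, 159), (197, 160), (205, 162), (213, 165), (221, 170), (228, 175), (233, 183), (237, 192), (239, 199), (241, 207), (239, 216), (236, 223), (232, 230)],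
   [(182, 171), (187, 168), (194, 167), (201, 169), (207, 169), (215, 173), (219, 179), (225, 182), (229, 190), (231, 196), (233, 202), (232, 211), (231, 215), (228, 221), (224, 227)]),
  (false, [2, 1, 0, 3, 4, 7, 6, 5],
   [(163, 151), (175, 145), (184, 143), (196, 141), (211, 146), (219, 150), (232, 157), (240, 165), (248, 176), (255, 189), (256, 199), (257, 212), (256, 222), (252, 235), (244, 243)],
   [(176, 158), (183, 153), (192, 154), (203, 154), (212, 156), (220, 163), (231, 167), (236, 178), (240, 184), (248, 195), (244, 205), (248, 214), (244, 224), (237, 230), (236, 239)]),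
  (false, [1, 2, 0, 3, 4, 7, 6, 5],
   [(166, 154), (176, 148), (185, 145), (196, 147), (210, 150), (218, 153), (229, 160), (237, 168), (245, 180), (251, 190), (252, 199), (253, 212), (252, 223), (249, 233), (241, 240)],
   [(177, 161), (184, 156), (193, 157), (202, 157), (211, 159), (219, 166), (228, 171), (234, 178), (237, 187), (244, 196), (242, 205), (244, 215), (241, 221), (235, 230), (233, 237)]),
  (false, [1, 0, 2, 3, 4, 7, 6, 5],
   [(153, 136), (165, 128), (176, 126), (197, 129), (210, 131), (224, 134), (238, 146), (250, 157), (263, 173), (268, 184), (271, 198), (273, 218), (274, 231), (266, 244), (258, 253)],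
   [(167, 148), (177, 139), (189, 142), (202, 140), (213, 145), (226, 154), (239, 159), (242, 170), (255, 182), (257, 195), (259, 206), (262, 220), (253, 228), (253, 242), (244, 250)]),
  (false, [0, 1, 2, 3, 4, 7, 6, 5],
   [(150, 133), (161, 123), (178, 124), (196, 126), (209, 128), (223, 132), (239, 144), (254, 157), (263, 173), (269, 184), (273, 199), (278, 221), (276, 233), (267, 247), (260, 256)],
   [(166, 145), (176, 136), (187, 140), (202, 137), (213, 143), (228, 154), (237, 156), (245, 171), (256, 182), (259, 195), (262, 209), (261, 220), (258, 231), (254, 245), (246, 252)]),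
  (false, [2, 1, 0, 3, 4, 7, 6, 5],
   [(155, 141), (169, 133), (180, 131), (195, 129), (214, 135), (223, 139), (238, 147), (249, 159), (259, 170), (267, 187), (268, 198), (269, 214), (269, 228), (264, 241), (253, 252)],
   [(170, 149), (180, 145), (190, 142), (203, 146), (215, 146), (224, 155), (238, 161), (244, 172), (248, 181), (259, 194), (254, 206), (258, 216), (254, 230), (245, 235), (244, 248)]),
  (false, [1, 2, 0, 3, 4, 7, 6, 5],
   [(157, 144), (170, 136), (181, 132), (195, 134), (212, 139), (222, 142), (236, 150), (246, 161), (256, 174), (263, 189), (265, 198), (266, 214), (265, 229), (261, 240), (251, 250)],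
   [(171, 152), (180, 147), (191, 145), (202, 149), (214, 148), (223, 158), (235, 165), (242, 172), (246, 184), (255, 195), (252, 206), (255, 218), (251, 227), (244, 235), (241, 247)]),
  (false, [1, 0, 2, 3, 4, 7, 6, 5],
   [(156, 142), (170, 132), (180, 131), (198, 134), (212, 137), (222, 141), (238, 149), (248, 162), (258, 176), (264, 188), (266, 199), (268, 217), (268, 231), (260, 242), (252, 251)],
   [(172, 150), (180, 145), (190, 145), (204, 146), (214, 148), (224, 159), (238, 163), (240, 173), (250, 185), (256, 195), (252, 209), (258, 218), (250, 228), (246, 239), (242, 247)]),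
  (false, [0, 1, 2, 3, 4, 7, 6, 5],
   [(161, 151), (173, 141), (186, 142), (198, 144), (209, 147), (217, 150), (234, 157), (242, 169), (248, 180), (253, 191), (256, 199), (261, 216), (256, 227), (250, 236), (244, 244)],
   [(178, 158), (181, 153), (192, 153), (203, 155), (212, 155), (222, 167), (229, 168), (236, 178), (242, 188), (248, 196), (244, 209), (248, 215), (244, 225), (239, 233), (236, 241)])]

def tab2 : List Dat :=
  [(true, [4, 3, 2, 1, 0, 5, 7, 6],
   [(164, 160), (176, 155), (186, 152), (194, 150), (204, 149), (217, 148), (227, 156), (235, 163), (240, 169), (246, 177), (253, 188), (251, 201), (249, 211), (246, 219), (242, 228)],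
   [(174, 168), (184, 162), (191, 158), (200, 158), (211, 160), (215, 161), (225, 166), (232, 171), (236, 178), (240, 189), (241, 193), (241, 204), (241, 213), (236, 220), (229, 229)]),
  (true, [3, 4, 2, 1, 0, 5, 7, 6],
   [(160, 155), (172, 150), (182, 146), (192, 144), (208, 141), (217, 142), (230, 151), (239, 158), (246, 164), (255, 174), (257, 187), (258, 201), (257, 212), (254, 220), (247, 233)],
   [(173, 164), (181, 157), (189, 152), (201, 154), (210, 154), (218, 156), (229, 162), (236, 166), (239, 177), (248, 186), (245, 192), (248, 205), (247, 214), (238, 223), (238, 232)]),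
  (true, [3, 2, 4, 1, 0, 5, 7, 6],
   [(168, 163), (177, 159), (185, 156), (196, 153), (207, 151), (215, 154), (225, 160), (233, 165), (240, 171), (245, 179), (247, 191), (248, 201), (248, 209), (244, 218), (238, 228)],
   [(178, 169), (185, 164), (192, 162), (201, 161), (209, 163), (216, 164), (225, 168), (229, 174), (234, 181), (239, 188), (238, 195), (240, 204), (237, 212), (233, 220), (230, 225)]),
  (true, [2, 3, 4, 1, 0, 5, 7, 6],
   [(154, 145), (166, 139), (177, 135), (196, 129), (209, 130), (222, 132), (236, 141), (248, 149), (259, 158), (265, 171), (268, 187), (270, 202), (271, 214), (263, 229), (256, 241)],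
   [(168, 154), (178, 147), (188, 144), (202, 142), (212, 146), (224, 147), (237, 153), (240, 164), (252, 170), (255, 185), (256, 193), (259, 206), (252, 220), (250, 228), (243, 239)]),
  (false, [4, 3, 2, 1, 0, 5, 7, 6],
   [(159, 152), (173, 147), (182, 144), (196, 141), (205, 140), (220, 139), (233, 150), (240, 156), (249, 165), (254, 173), (261, 187), (260, 203), (258, 212), (253, 224), (249, 233)],
   [(172, 163), (180, 153), (191, 153), (201, 149), (212, 154), (219, 155), (231, 159), (235, 168), (245, 174), (246, 188), (247, 192), (251, 206), (244, 215), (244, 225), (234, 234)]),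
  (false, [3, 4, 2, 1, 0, 5, 7, 6],
   [(155, 146), (168, 141), (179, 137), (194, 134), (208, 132), (221, 133), (236, 144), (245, 151), (255, 161), (263, 170), (266, 187), (268, 203), (266, 214), (261, 227), (255, 238)],
   [(170, 157), (177, 148), (189, 147), (202, 143), (211, 149), (223, 149), (234, 155), (240, 164), (249, 172), (253, 186), (253, 192), (257, 207), (251, 217), (247, 229), (242, 237)]),
  (false, [3, 2, 4, 1, 0, 5, 7, 6],
   [(165, 157), (175, 153), (183, 150), (196, 147), (206, 146), (217, 149), (228, 156), (235, 162), (244, 170), (249, 178), (252, 192), (253, 203), (252, 212), (248, 223), (243, 232)],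
   [(176, 164), (182, 159), (192, 158), (201, 155), (209, 160), (218, 160), (227, 165), (231, 173), (239, 179), (241, 189), (242, 196), (245, 206), (239, 215), (238, 224), (232, 229)]),
  (false, [2, 3, 4, 1, 0, 5, 7, 6],
   [(160, 150), (171, 144), (180, 141), (196, 136), (209, 138), (221, 140), (233, 148), (242, 155), (253, 165), (259, 176), (261, 190), (262, 204), (262, 214), (257, 229), (250, 238)],
   [(172, 158), (180, 151), (191, 151), (202, 147), (211, 152), (222, 154), (233, 158), (237, 170), (246, 174), (249, 188), (250, 196), (253, 207), (246, 219), (244, 227), (238, 236)]),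
  (false, [3, 2, 1, 4, 0, 5, 7, 6],
   [(171, 164), (178, 161), (186, 158), (195, 156), (205, 155), (214, 159), (222, 164), (229, 169), (236, 176), (241, 183), (243, 195), (244, 203), (243, 211), (241, 220), (236, 228)],
   [(179, 169), (185, 166), (193, 165), (200, 163), (207, 167), (215, 167), (221, 172), (227, 178), (231, 184), (234, 191), (236, 198), (236, 206), (234, 213), (231, 221), (227, 224)]),
  (false, [2, 3, 1, 4, 0, 5, 7, 6],
   [(177, 172), (183, 169), (189, 167), (197, 165), (203, 166), (211, 168), (218, 172), (223, 176), (228, 182), (232, 188), (234, 196), (235, 203), (234, 209), (231, 217), (229, 222)],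
   [(184, 176), (188, 173), (194, 173), (201, 171), (205, 174), (212, 175), (217, 178), (220, 184), (226, 187), (226, 194), (228, 199), (229, 205), (226, 211), (225, 216), (221, 220)]),
  (false, [2, 1, 3, 4, 0, 5, 7, 6],
   [(133, 108), (152, 99), (168, 93), (193, 92), (215, 94), (241, 97), (259, 114), (272, 127), (292, 149), (303, 164), (308, 189), (307, 215), (304, 234), (299, 257), (288, 270)],
   [(151, 125), (165, 112), (188, 115), (204, 107), (220, 119), (240, 123), (256, 133), (267, 150), (281, 162), (282, 186), (289, 198), (291, 221), (279, 235), (277, 255), (262, 267)]),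
  (false, [1, 2, 3, 4, 0, 5, 7, 6],
   [(149, 129), (162, 122), (175, 116), (195, 117), (212, 118), (232, 120), (246, 133), (256, 143), (272, 161), (281, 172), (283, 191), (284, 211), (281, 227), (277, 244), (269, 254)],
   [(163, 142), (172, 132), (191, 134), (204, 128), (214, 137), (233, 140), (243, 149), (252, 160), (264, 171), (263, 189), (270, 198), (271, 217), (261, 226), (260, 243), (249, 252)]),
  (false, [3, 2, 1, 4, 0, 5, 7, 6],
   [(172, 165), (178, 162), (186, 159), (195, 157), (204, 156), (214, 161), (221, 165), (228, 170), (235, 177), (240, 184), (242, 196), (243, 203), (242, 211), (240, 220), (236, 228)],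
   [(179, 169), (185, 167), (193, 166), (200, 164), (206, 168), (215, 168), (220, 173), (226, 179), (231, 185), (232, 191), (236, 199), (235, 206), (233, 213), (231, 221), (226, 223)]),
  (false, [2, 3, 1, 4, 0, 5, 7, 6],
   [(168, 162), (176, 158), (185, 155), (196, 152), (203, 153), (214, 157), (224, 162), (231, 167), (238, 175), (242, 184), (246, 195), (248, 204), (246, 212), (242, 223), (239, 231)],
   [(178, 167), (183, 163), (192, 163), (200, 161), (207, 164), (216, 166), (222, 170), (227, 178), (235, 183), (235, 191), (238, 199), (239, 207), (235, 215), (235, 222), (228, 227)]),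
  (false, [2, 1, 3, 4, 0, 5, 7, 6],
   [(166, 158), (173, 153), (185, 148), (195, 147), (206, 149), (217, 152), (226, 157), (236, 163), (243, 174), (248, 183), (251, 194), (253, 204), (251, 215), (248, 227), (242, 234)],
   [(175, 163), (183, 159), (192, 159), (200, 156), (209, 160), (219, 162), (224, 168), (233, 175), (237, 181), (240, 191), (244, 199), (241, 209), (241, 216), (237, 225), (231, 231)]),
  (false, [1, 2, 3, 4, 0, 5, 7, 6],
   [(167, 159), (174, 155), (185, 149), (196, 150), (205, 151), (216, 154), (225, 159), (234, 165), (242, 176), (245, 184), (249, 195), (251, 204), (249, 216), (246, 226), (240, 233)],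
   [(176, 164), (183, 161), (193, 160), (199, 158), (209, 162), (218, 163), (223, 171), (231, 175), (236, 183), (238, 192), (242, 199), (240, 210), (238, 215), (237, 225), (229, 230)])]

def tab3 : List Dat :=
  [(true, [3, 2, 1, 0, 4, 5, 7, 6],
   [(166, 160), (176, 153), (186, 151), (194, 150), (205, 149), (217, 154), (226, 158), (234, 166), (240, 174), (246, 183), (251, 194), (250, 205), (248, 215), (246, 224), (241, 234)],
   [(175, 164), (184, 161), (192, 159), (200, 159), (210, 160), (216, 165), (224, 168), (232, 175), (235, 184), (239, 189), (241, 201), (240, 207), (240, 216), (235, 225), (229, 229)]),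
  (true, [2, 3, 1, 0, 4, 5, 7, 6],
   [(159, 152), (171, 144), (182, 141), (194, 139), (205, 140), (221, 145), (232, 149), (241, 159), (249, 169), (256, 180), (262, 193), (261, 205), (259, 218), (255, 230), (251, 240)],
   [(170, 156), (180, 154), (190, 151), (201, 150), (211, 153), (220, 157), (230, 162), (237, 171), (245, 179), (246, 188), (250, 201), (250, 208), (247, 220), (244, 229), (235, 235)]),
  (true, [2, 1, 3, 0, 4, 5, 7, 6],
   [(158, 150), (169, 142), (183, 138), (193, 136), (208, 139), (221, 143), (232, 147), (244, 158), (251, 168), (258, 181), (263, 193), (263, 205), (261, 220), (258, 232), (250, 242)],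
   [(169, 154), (181, 153), (190, 148), (200, 149), (213, 151), (221, 155), (230, 162), (241, 170), (243, 178), (250, 189), (252, 201), (249, 209), (251, 222), (243, 229), (237, 238)]),
  (true, [1, 2, 3, 0, 4, 5, 7, 6],
   [(169, 163), (178, 157), (186, 153), (197, 154), (205, 155), (216, 158), (225, 161), (232, 169), (239, 178), (243, 186), (247, 195), (247, 204), (246, 216), (242, 224), (238, 231)],
   [(178, 166), (185, 165), (193, 162), (201, 162), (209, 164), (216, 167), (224, 173), (228, 177), (235, 185), (236, 192), (238, 201), (239, 208), (235, 215), (234, 223), (227, 228)]),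
  (false, [3, 2, 1, 0, 4, 5, 7, 6],
   [(166, 156), (175, 151), (183, 149), (195, 147), (206, 146), (218, 152), (227, 158), (234, 164), (244, 174), (249, 182), (252, 196), (252, 207), (251, 215), (249, 227), (243, 236)],
   [(175, 162), (182, 157), (193, 159), (200, 155), (209, 160), (218, 163), (226, 166), (232, 176), (238, 183), (240, 190), (243, 201), (244, 209), (239, 217), (238, 228), (231, 230)]),
  (false, [2, 3, 1, 0, 4, 5, 7, 6],
   [(162, 151), (172, 145), (181, 142), (195, 139), (207, 140), (221, 146), (231, 152), (239, 159), (250, 170), (256, 181), (259, 195), (259, 207), (258, 217), (255, 231), (249, 241)],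
   [(172, 157), (180, 152), (192, 153), (201, 150), (210, 154), (221, 158), (230, 162), (236, 173), (244, 180), (245, 189), (249, 201), (250, 210), (244, 220), (243, 230), (235, 235)]),
  (false, [2, 1, 3, 0, 4, 5, 7, 6],
   [(165, 156), (175, 150), (183, 147), (195, 145), (207, 148), (218, 152), (228, 157), (235, 164), (245, 175), (250, 185), (253, 196), (253, 207), (252, 217), (250, 230), (243, 237)],
   [(175, 161), (182, 157), (193, 158), (200, 155), (210, 159), (218, 163), (227, 167), (233, 177), (238, 182), (242, 192), (243, 202), (245, 210), (240, 219), (238, 227), (232, 233)]),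
  (false, [1, 2, 3, 0, 4, 5, 7, 6],
   [(177, 172), (183, 168), (189, 165), (198, 166), (204, 167), (211, 169), (218, 172), (224, 177), (229, 185), (232, 190), (234, 197), (235, 204), (235, 212), (231, 219), (228, 223)],
   [(184, 175), (189, 173), (194, 173), (201, 171), (206, 174), (212, 176), (218, 180), (220, 184), (226, 189), (227, 195), (228, 201), (229, 207), (226, 211), (225, 218), (221, 221)]),
  (false, [2, 1, 0, 3, 4, 5, 7, 6],
   [(157, 145), (170, 136), (179, 134), (196, 133), (210, 137), (222, 141), (236, 147), (245, 158), (256, 172), (263, 183), (265, 196), (266, 211), (266, 224), (260, 239), (253, 246)],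
   [(171, 151), (179, 147), (190, 148), (203, 144), (212, 150), (223, 156), (236, 160), (239, 173), (249, 179), (253, 192), (252, 205), (257, 213), (249, 225), (246, 235), (241, 242)]),
  (false, [1, 2, 0, 3, 4, 5, 7, 6],
   [(167, 158), (177, 150), (184, 147), (198, 149), (208, 151), (217, 154), (228, 158), (235, 167), (244, 179), (248, 187), (250, 196), (251, 208), (251, 220), (246, 230), (240, 236)],
   [(178, 162), (184, 159), (193, 159), (202, 157), (210, 160), (218, 166), (228, 170), (230, 177), (238, 185), (241, 193), (240, 204), (244, 211), (237, 218), (236, 228), (231, 233)]),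
  (false, [1, 0, 2, 3, 4, 5, 7, 6],
   [(135, 113), (152, 99), (170, 97), (199, 100), (213, 102), (235, 108), (256, 120), (272, 137), (288, 161), (294, 173), (300, 195), (304, 221), (302, 240), (289, 261), (281, 271)],
   [(156, 125), (168, 116), (186, 121), (205, 112), (219, 124), (239, 134), (254, 139), (259, 158), (280, 171), (278, 189), (283, 209), (286, 223), (273, 237), (275, 259), (259, 265)]),
  (false, [0, 1, 2, 3, 4, 5, 7, 6],
   [(140, 121), (154, 107), (175, 108), (199, 110), (210, 111), (231, 116), (251, 128), (267, 144), (279, 165), (284, 175), (291, 195), (297, 221), (292, 236), (280, 255), (274, 264)],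
   [(160, 133), (170, 123), (187, 129), (204, 120), (217, 131), (237, 142), (246, 143), (255, 163), (273, 174), (270, 190), (277, 209), (276, 220), (268, 234), (269, 254), (253, 259)]),
  (false, [2, 1, 0, 3, 4, 5, 7, 6],
   [(151, 140), (167, 128), (179, 126), (194, 125), (212, 130), (225, 134), (241, 140), (251, 153), (262, 168), (270, 182), (274, 194), (274, 212), (272, 227), (268, 243), (258, 252)],
   [(167, 146), (177, 141), (190, 141), (202, 139), (216, 142), (225, 152), (239, 155), (247, 169), (252, 177), (261, 190), (258, 206), (262, 214), (257, 228), (250, 238), (245, 248)]),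
  (false, [1, 2, 0, 3, 4, 5, 7, 6],
   [(155, 144), (169, 133), (181, 130), (195, 132), (209, 135), (224, 139), (238, 144), (247, 157), (257, 172), (264, 183), (269, 195), (269, 211), (266, 227), (262, 240), (255, 248)],
   [(169, 149), (178, 146), (191, 145), (202, 143), (214, 147), (224, 155), (235, 160), (243, 170), (250, 180), (254, 191), (255, 206), (257, 214), (252, 225), (248, 237), (240, 244)]),
  (false, [1, 0, 2, 3, 4, 5, 7, 6],
   [(161, 151), (172, 141), (182, 140), (199, 142), (208, 144), (219, 147), (233, 152), (242, 164), (251, 177), (255, 185), (258, 196), (261, 211), (260, 224), (252, 235), (247, 241)],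
   [(175, 156), (181, 153), (191, 153), (203, 150), (211, 155), (222, 162), (232, 165), (234, 175), (246, 183), (247, 193), (247, 206), (251, 212), (243, 222), (243, 233), (236, 238)]),
  (false, [0, 1, 2, 3, 4, 5, 7, 6],
   [(145, 132), (160, 117), (178, 118), (198, 121), (209, 123), (225, 127), (247, 135), (258, 152), (269, 170), (274, 180), (280, 195), (287, 218), (280, 234), (271, 249), (265, 257)],
   [(167, 140), (171, 134), (189, 136), (203, 131), (215, 138), (232, 150), (240, 151), (249, 167), (263, 178), (264, 191), (265, 210), (269, 217), (260, 231), (260, 247), (249, 253)])]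

def tab4 : List Dat :=
  [(true, [4, 3, 2, 1, 0, 7, 5, 6],
   [(150, 144), (168, 138), (181, 134), (190, 132), (207, 130), (223, 129), (238, 142), (248, 151), (254, 158), (265, 171), (273, 185), (270, 204), (267, 217), (264, 226), (258, 241)],
   [(165, 157), (178, 147), (187, 141), (201, 145), (215, 144), (220, 148), (235, 155), (245, 160), (248, 173), (257, 186), (255, 191), (257, 208), (258, 219), (247, 228), (242, 242)]),
  (true, [3, 4, 2, 1, 0, 7, 5, 6],
   [(144, 135), (162, 128), (177, 124), (189, 121), (210, 118), (225, 120), (242, 133), (255, 144), (263, 152), (275, 167), (281, 185), (280, 205), (278, 220), (274, 231), (265, 249)],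
   [(161, 148), (175, 139), (185, 132), (201, 136), (216, 136), (224, 140), (240, 148), (251, 155), (254, 170), (266, 183), (263, 192), (265, 209), (266, 223), (253, 234), (250, 247)]),
  (true, [3, 2, 4, 1, 0, 7, 5, 6],
   [(153, 144), (167, 139), (181, 135), (195, 132), (209, 130), (221, 133), (238, 144), (248, 152), (257, 160), (263, 173), (268, 189), (271, 205), (267, 217), (262, 228), (254, 243)],
   [(170, 155), (177, 147), (190, 143), (201, 145), (214, 146), (224, 149), (234, 156), (243, 163), (249, 175), (256, 186), (254, 194), (257, 209), (253, 220), (248, 230), (242, 240)]),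
  (true, [2, 3, 4, 1, 0, 7, 5, 6],
   [(146, 134), (162, 128), (176, 123), (194, 118), (212, 119), (225, 121), (244, 134), (256, 143), (267, 153), (276, 170), (279, 187), (282, 206), (280, 220), (273, 235), (264, 251)],
   [(165, 147), (174, 137), (187, 133), (203, 135), (215, 136), (228, 140), (242, 148), (249, 158), (258, 169), (266, 185), (263, 193), (268, 211), (262, 225), (255, 234), (251, 249)]),
  (false, [4, 3, 2, 1, 0, 7, 5, 6],
   [(133, 119), (157, 112), (173, 108), (191, 106), (211, 104), (232, 102), (255, 123), (266, 134), (278, 147), (290, 162), (299, 183), (298, 211), (293, 226), (287, 241), (279, 258)],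
   [(156, 140), (168, 123), (185, 121), (203, 121), (220, 125), (231, 130), (250, 138), (260, 149), (270, 164), (278, 185), (275, 190), (282, 215), (275, 228), (267, 243), (258, 260)]),
  (false, [3, 4, 2, 1, 0, 7, 5, 6],
   [(143, 129), (161, 123), (176, 120), (192, 117), (212, 114), (227, 116), (247, 132), (258, 142), (269, 153), (280, 166), (284, 187), (286, 209), (282, 222), (277, 236), (268, 252)],
   [(163, 145), (172, 133), (187, 131), (203, 130), (216, 135), (229, 138), (243, 145), (253, 156), (260, 169), (269, 185), (266, 193), (271, 212), (266, 225), (257, 239), (253, 250)]),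
  (false, [3, 2, 4, 1, 0, 7, 5, 6],
   [(166, 157), (176, 153), (185, 151), (196, 149), (207, 148), (216, 150), (228, 159), (235, 165), (242, 172), (248, 181), (250, 193), (252, 206), (250, 214), (246, 223), (241, 233)],
   [(178, 166), (183, 159), (192, 158), (202, 158), (209, 160), (218, 163), (226, 167), (231, 174), (237, 182), (241, 191), (240, 197), (243, 208), (239, 216), (235, 224), (232, 231)]),
  (false, [2, 3, 4, 1, 0, 7, 5, 6],
   [(155, 143), (169, 138), (179, 135), (195, 132), (210, 133), (221, 134), (237, 146), (246, 154), (256, 164), (264, 176), (266, 191), (268, 208), (267, 219), (261, 232), (254, 243)],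
   [(171, 155), (178, 146), (189, 145), (203, 144), (212, 148), (223, 151), (236, 157), (240, 167), (249, 175), (255, 190), (252, 196), (258, 211), (251, 222), (246, 231), (243, 242)]),
  (false, [3, 2, 1, 4, 0, 7, 5, 6],
   [(167, 157), (176, 154), (185, 152), (195, 150), (207, 149), (216, 153), (226, 160), (234, 167), (241, 174), (247, 182), (249, 196), (250, 206), (249, 215), (246, 224), (240, 233)],
   [(177, 164), (184, 161), (192, 159), (201, 158), (209, 163), (217, 163), (225, 169), (231, 176), (235, 183), (240, 192), (240, 199), (241, 208), (239, 217), (234, 225), (231, 229)]),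
  (false, [2, 3, 1, 4, 0, 7, 5, 6],
   [(169, 160), (177, 157), (186, 154), (197, 152), (205, 153), (215, 156), (225, 163), (232, 168), (239, 176), (243, 185), (246, 196), (248, 206), (246, 214), (242, 224), (238, 232)],
   [(179, 167), (184, 162), (193, 162), (201, 161), (208, 164), (217, 166), (223, 171), (228, 178), (235, 184), (236, 193), (238, 199), (239, 209), (235, 216), (234, 223), (228, 229)]),
  (false, [2, 1, 3, 4, 0, 7, 5, 6],
   [(151, 133), (165, 128), (177, 124), (194, 123), (211, 125), (227, 127), (242, 140), (252, 150), (264, 164), (274, 176), (276, 194), (277, 212), (275, 226), (270, 241), (263, 251)],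
   [(166, 146), (175, 138), (189, 138), (204, 135), (213, 143), (228, 145), (240, 154), (247, 165), (257, 174), (260, 192), (262, 199), (265, 216), (258, 227), (253, 239), (247, 249)]),
  (false, [1, 2, 3, 4, 0, 7, 5, 6],
   [(149, 132), (162, 126), (175, 121), (194, 122), (209, 123), (227, 125), (242, 138), (252, 148), (267, 164), (274, 175), (278, 193), (280, 212), (277, 227), (273, 242), (265, 252)],
   [(164, 145), (172, 136), (190, 137), (201, 133), (213, 141), (229, 144), (239, 153), (248, 163), (259, 174), (260, 191), (265, 199), (267, 217), (258, 226), (258, 241), (247, 250)]),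
  (false, [3, 2, 1, 4, 0, 7, 5, 6],
   [(165, 157), (175, 154), (186, 151), (195, 149), (206, 148), (216, 153), (227, 160), (236, 166), (241, 173), (247, 183), (251, 196), (252, 206), (250, 215), (246, 224), (241, 235)],
   [(176, 164), (184, 160), (191, 158), (201, 159), (210, 161), (217, 163), (225, 169), (232, 175), (236, 184), (241, 191), (241, 199), (241, 209), (241, 217), (235, 225), (231, 230)]),
  (false, [2, 3, 1, 4, 0, 7, 5, 6],
   [(148, 133), (160, 128), (176, 123), (195, 119), (208, 121), (226, 126), (242, 137), (254, 147), (267, 158), (273, 175), (278, 193), (282, 209), (278, 224), (272, 239), (265, 254)],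
   [(164, 144), (172, 138), (189, 134), (201, 136), (213, 139), (230, 142), (238, 152), (248, 162), (260, 173), (260, 188), (266, 198), (266, 214), (259, 228), (259, 237), (247, 249)]),
  (false, [2, 1, 3, 4, 0, 7, 5, 6],
   [(162, 153), (172, 149), (185, 144), (195, 143), (207, 145), (218, 148), (230, 155), (240, 162), (246, 172), (252, 183), (256, 195), (258, 206), (255, 218), (251, 229), (245, 238)],
   [(174, 160), (182, 156), (191, 154), (201, 154), (211, 157), (220, 159), (227, 167), (236, 173), (240, 181), (245, 192), (246, 199), (245, 211), (245, 219), (239, 227), (234, 235)]),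
  (false, [1, 2, 3, 4, 0, 7, 5, 6],
   [(163, 153), (171, 149), (184, 143), (196, 144), (206, 145), (218, 148), (229, 155), (239, 162), (247, 173), (251, 183), (255, 195), (258, 206), (255, 219), (251, 229), (245, 238)],
   [(174, 160), (181, 156), (192, 154), (200, 154), (210, 157), (221, 159), (226, 168), (235, 172), (241, 182), (243, 192), (247, 199), (245, 212), (243, 218), (241, 228), (233, 235)])]

def tab5 : List Dat :=
  [(true, [3, 2, 1, 0, 4, 7, 5, 6],
   [(166, 159), (174, 154), (185, 151), (193, 150), (204, 149), (217, 155), (225, 159), (234, 167), (240, 174), (247, 184), (251, 196), (251, 205), (249, 216), (247, 224), (243, 235)],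
   [(174, 163), (183, 162), (191, 158), (200, 160), (208, 161), (217, 164), (223, 170), (232, 175), (236, 185), (238, 190), (243, 201), (240, 208), (241, 217), (236, 225), (230, 229)]),
  (true, [2, 3, 1, 0, 4, 7, 5, 6],
   [(167, 159), (175, 154), (185, 151), (195, 149), (205, 150), (217, 155), (225, 159), (234, 167), (241, 174), (246, 185), (250, 196), (250, 205), (249, 216), (246, 225), (241, 235)],
   [(175, 163), (184, 162), (192, 158), (200, 160), (209, 161), (217, 164), (224, 170), (231, 176), (236, 184), (238, 191), (242, 201), (240, 208), (239, 218), (236, 224), (229, 230)]),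
  (true, [2, 1, 3, 0, 4, 7, 5, 6],
   [(174, 167), (181, 163), (190, 160), (196, 159), (205, 161), (214, 164), (221, 167), (228, 174), (232, 180), (237, 189), (240, 197), (240, 204), (238, 214), (236, 221), (232, 228)],
   [(181, 170), (188, 170), (194, 166), (201, 168), (208, 169), (214, 171), (219, 177), (226, 181), (228, 187), (231, 194), (233, 201), (231, 207), (232, 215), (227, 219), (223, 225)]),
  (true, [1, 2, 3, 0, 4, 7, 5, 6],
   [(165, 156), (173, 151), (185, 145), (195, 146), (207, 149), (218, 152), (227, 156), (238, 165), (244, 175), (250, 186), (253, 196), (254, 205), (253, 220), (249, 229), (243, 237)],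
   [(174, 160), (184, 160), (191, 155), (201, 157), (210, 159), (219, 161), (226, 171), (234, 174), (238, 183), (242, 193), (245, 201), (242, 211), (243, 219), (237, 226), (232, 234)]),
  (false, [3, 2, 1, 0, 4, 7, 5, 6],
   [(170, 160), (177, 157), (185, 155), (194, 153), (204, 151), (216, 158), (223, 163), (230, 169), (237, 176), (244, 184), (246, 198), (246, 206), (245, 214), (243, 223), (240, 233)],
   [(177, 165), (184, 163), (192, 162), (201, 161), (206, 165), (216, 166), (222, 171), (228, 178), (234, 186), (234, 191), (239, 201), (238, 208), (236, 216), (233, 225), (228, 226)]),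
  (false, [2, 3, 1, 0, 4, 7, 5, 6],
   [(180, 173), (184, 171), (190, 169), (198, 167), (203, 168), (211, 172), (216, 175), (221, 179), (227, 184), (229, 191), (231, 199), (232, 204), (231, 210), (229, 217), (226, 223)],
   [(185, 176), (189, 175), (196, 174), (200, 174), (205, 176), (212, 177), (215, 181), (219, 186), (224, 190), (223, 195), (227, 201), (226, 206), (223, 212), (224, 216), (218, 219)]),
  (false, [2, 1, 3, 0, 4, 7, 5, 6],
   [(170, 161), (177, 157), (187, 154), (195, 153), (206, 156), (215, 159), (223, 164), (232, 171), (237, 179), (243, 189), (245, 198), (246, 207), (245, 217), (242, 226), (237, 233)],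
   [(178, 166), (186, 164), (192, 162), (201, 163), (208, 165), (216, 168), (222, 174), (229, 180), (232, 186), (236, 195), (238, 202), (236, 210), (237, 218), (231, 223), (228, 230)]),
  (false, [1, 2, 3, 0, 4, 7, 5, 6],
   [(176, 169), (181, 166), (189, 163), (197, 164), (203, 165), (212, 168), (218, 172), (225, 177), (230, 185), (233, 191), (236, 199), (237, 206), (236, 214), (233, 221), (230, 226)],
   [(182, 173), (188, 171), (194, 171), (200, 170), (206, 173), (213, 175), (217, 180), (222, 184), (227, 190), (227, 196), (231, 202), (229, 209), (228, 213), (227, 220), (221, 223)]),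
  (false, [2, 1, 0, 3, 4, 7, 5, 6],
   [(166, 155), (176, 149), (185, 147), (195, 146), (209, 150), (218, 154), (228, 159), (236, 168), (244, 178), (250, 189), (252, 199), (252, 210), (251, 221), (249, 232), (241, 239)],
   [(176, 160), (184, 158), (193, 157), (201, 157), (211, 160), (218, 165), (227, 170), (234, 179), (236, 185), (243, 195), (242, 205), (243, 212), (241, 222), (235, 228), (232, 235)]),
  (false, [1, 2, 0, 3, 4, 7, 5, 6],
   [(165, 153), (175, 147), (184, 143), (196, 145), (209, 148), (219, 152), (230, 157), (238, 167), (246, 178), (253, 189), (254, 199), (255, 210), (254, 224), (250, 233), (244, 241)],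
   [(176, 158), (183, 157), (192, 154), (203, 156), (210, 158), (220, 163), (229, 171), (234, 176), (240, 186), (244, 195), (244, 205), (246, 214), (242, 222), (237, 230), (234, 237)]),
  (false, [1, 0, 2, 3, 4, 7, 5, 6],
   [(156, 140), (169, 132), (179, 130), (198, 133), (210, 135), (224, 138), (238, 148), (248, 159), (259, 175), (265, 184), (268, 198), (269, 216), (269, 229), (261, 242), (255, 249)],
   [(170, 150), (179, 143), (190, 146), (204, 142), (213, 149), (225, 156), (238, 161), (240, 172), (253, 182), (254, 195), (255, 206), (259, 218), (250, 226), (249, 240), (241, 246)]),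
  (false, [0, 1, 2, 3, 4, 7, 5, 6],
   [(148, 130), (160, 119), (178, 120), (198, 122), (210, 124), (227, 128), (244, 139), (258, 154), (269, 171), (274, 181), (279, 198), (284, 220), (280, 234), (271, 249), (264, 257)],
   [(165, 141), (174, 134), (189, 137), (203, 132), (215, 141), (232, 150), (240, 153), (249, 169), (262, 179), (262, 194), (267, 209), (266, 219), (260, 232), (259, 247), (247, 253)]),
  (false, [2, 1, 0, 3, 4, 7, 5, 6],
   [(157, 145), (170, 136), (181, 134), (193, 133), (211, 139), (222, 143), (235, 148), (245, 161), (254, 173), (263, 187), (265, 198), (265, 212), (264, 227), (261, 240), (252, 248)],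
   [(170, 150), (180, 149), (190, 146), (202, 147), (213, 150), (222, 157), (234, 163), (242, 174), (245, 181), (254, 194), (252, 207), (254, 214), (252, 228), (243, 234), (241, 244)]),
  (false, [1, 2, 0, 3, 4, 7, 5, 6],
   [(158, 145), (170, 137), (181, 133), (195, 135), (211, 139), (222, 143), (235, 149), (245, 161), (255, 174), (262, 187), (264, 198), (265, 212), (264, 228), (260, 239), (251, 248)],
   [(171, 151), (180, 149), (191, 146), (202, 148), (213, 150), (223, 157), (234, 165), (241, 172), (246, 183), (253, 194), (252, 206), (254, 216), (250, 226), (244, 235), (240, 244)]),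
  (false, [1, 0, 2, 3, 4, 7, 5, 6],
   [(162, 151), (173, 142), (182, 140), (198, 143), (209, 146), (219, 149), (232, 154), (241, 166), (250, 179), (255, 188), (257, 198), (259, 212), (259, 226), (252, 236), (246, 242)],
   [(175, 156), (182, 154), (191, 153), (203, 152), (211, 156), (221, 163), (232, 168), (234, 176), (244, 185), (247, 195), (246, 207), (250, 214), (243, 223), (241, 233), (236, 239)]),
  (false, [0, 1, 2, 3, 4, 7, 5, 6],
   [(166, 156), (175, 148), (188, 149), (198, 150), (206, 152), (216, 155), (229, 160), (237, 172), (242, 181), (246, 189), (250, 199), (254, 212), (249, 223), (244, 231), (240, 237)],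
   [(179, 161), (183, 160), (193, 158), (202, 158), (210, 162), (220, 168), (224, 171), (232, 180), (238, 187), (240, 196), (241, 207), (241, 211), (239, 222), (236, 229), (230, 234)])]

def tab6 : List Dat :=
  [(true, [4, 3, 2, 1, 0, 5, 6, 7],
   [(154, 151), (172, 143), (181, 140), (193, 137), (206, 135), (221, 133), (236, 145), (243, 151), (251, 160), (259, 170), (267, 182), (264, 202), (262, 211), (258, 223), (253, 235)],
   [(169, 163), (179, 149), (189, 149), (201, 147), (214, 147), (218, 153), (234, 154), (239, 163), (246, 172), (252, 184), (249, 190), (255, 205), (250, 214), (245, 225), (238, 237)]),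
  (true, [3, 4, 2, 1, 0, 5, 6, 7],
   [(170, 167), (179, 161), (185, 159), (195, 157), (206, 155), (213, 156), (223, 162), (229, 167), (236, 173), (242, 180), (243, 189), (244, 201), (244, 208), (241, 216), (236, 225)],
   [(180, 173), (185, 166), (192, 165), (201, 164), (207, 164), (214, 168), (223, 169), (226, 175), (231, 182), (236, 188), (234, 195), (238, 203), (234, 210), (230, 218), (229, 224)]),
  (true, [3, 2, 4, 1, 0, 5, 6, 7],
   [(170, 165), (179, 160), (185, 157), (197, 154), (207, 153), (215, 155), (225, 161), (231, 165), (239, 172), (244, 180), (245, 190), (246, 201), (246, 208), (242, 218), (237, 227)],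
   [(180, 171), (185, 164), (193, 164), (202, 162), (208, 163), (216, 166), (225, 168), (227, 175), (234, 181), (237, 188), (236, 195), (240, 204), (234, 211), (232, 219), (229, 225)]),
  (true, [2, 3, 4, 1, 0, 5, 6, 7],
   [(170, 165), (179, 160), (185, 157), (197, 153), (207, 154), (215, 155), (225, 161), (231, 165), (239, 172), (244, 181), (245, 190), (246, 201), (246, 208), (242, 219), (237, 227)],
   [(180, 171), (185, 164), (193, 164), (202, 162), (208, 163), (216, 166), (225, 168), (227, 176), (234, 180), (237, 189), (236, 195), (240, 204), (234, 212), (232, 218), (229, 226)]),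
  (false, [4, 3, 2, 1, 0, 5, 6, 7],
   [(146, 139), (166, 130), (177, 127), (194, 123), (206, 121), (228, 120), (244, 133), (252, 141), (264, 154), (271, 163), (282, 181), (278, 203), (275, 214), (270, 231), (265, 242)],
   [(162, 152), (174, 138), (189, 140), (201, 132), (217, 139), (224, 142), (241, 144), (247, 158), (259, 165), (260, 182), (262, 190), (267, 206), (258, 218), (258, 233), (243, 243)]),
  (false, [3, 4, 2, 1, 0, 5, 6, 7],
   [(162, 157), (175, 151), (182, 149), (195, 146), (205, 144), (218, 145), (230, 154), (236, 159), (245, 168), (251, 175), (256, 188), (255, 203), (254, 210), (250, 222), (246, 231)],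
   [(174, 166), (181, 156), (191, 158), (201, 153), (210, 157), (217, 160), (229, 161), (232, 171), (241, 177), (243, 187), (243, 194), (248, 205), (241, 213), (240, 224), (233, 230)]),
  (false, [3, 2, 4, 1, 0, 5, 6, 7],
   [(166, 159), (176, 154), (183, 151), (196, 148), (206, 146), (217, 150), (228, 157), (234, 161), (243, 170), (249, 178), (251, 191), (252, 203), (251, 210), (247, 222), (243, 232)],
   [(177, 166), (182, 158), (192, 160), (202, 156), (208, 159), (218, 162), (227, 164), (230, 173), (239, 180), (240, 187), (241, 196), (245, 206), (238, 213), (237, 224), (232, 228)]),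
  (false, [2, 3, 4, 1, 0, 5, 6, 7],
   [(158, 151), (171, 144), (179, 141), (195, 136), (208, 137), (220, 139), (234, 147), (242, 153), (252, 164), (260, 174), (262, 188), (263, 203), (263, 212), (257, 228), (252, 237)],
   [(172, 159), (179, 150), (189, 152), (203, 146), (210, 151), (221, 154), (234, 156), (236, 169), (247, 173), (250, 186), (249, 195), (255, 206), (247, 217), (244, 227), (240, 235)]),
  (false, [3, 2, 1, 4, 0, 5, 6, 7],
   [(166, 159), (176, 153), (183, 150), (195, 148), (206, 147), (217, 152), (227, 157), (233, 162), (243, 173), (248, 180), (251, 193), (251, 204), (250, 212), (248, 225), (242, 233)],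
   [(176, 164), (182, 158), (193, 161), (200, 155), (209, 160), (217, 163), (226, 165), (231, 175), (237, 181), (240, 188), (241, 199), (244, 207), (238, 214), (237, 226), (231, 228)]),
  (false, [2, 3, 1, 4, 0, 5, 6, 7],
   [(173, 168), (181, 163), (187, 161), (197, 158), (205, 159), (213, 162), (222, 166), (227, 170), (234, 178), (238, 185), (240, 194), (241, 203), (240, 209), (237, 220), (233, 226)],
   [(182, 172), (186, 167), (194, 169), (201, 165), (207, 168), (214, 171), (221, 172), (224, 181), (230, 184), (232, 191), (232, 199), (235, 205), (230, 212), (229, 219), (225, 223)]),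
  (false, [2, 1, 3, 4, 0, 5, 6, 7],
   [(78, 48), (119, 26), (147, 18), (187, 17), (217, 19), (270, 23), (302, 52), (324, 73), (353, 112), (370, 138), (392, 175), (383, 226), (377, 255), (366, 295), (353, 319)],
   [(110, 77), (141, 47), (176, 57), (204, 43), (239, 56), (261, 74), (296, 81), (313, 113), (340, 136), (339, 171), (351, 197), (355, 234), (337, 256), (336, 293), (300, 315)]),
  (false, [1, 2, 3, 4, 0, 5, 6, 7],
   [(111, 90), (141, 74), (161, 67), (191, 68), (212, 69), (250, 72), (274, 93), (290, 108), (311, 137), (323, 156), (339, 182), (333, 219), (329, 241), (320, 269), (311, 287)],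
   [(135, 111), (157, 89), (182, 96), (203, 87), (228, 95), (244, 109), (270, 115), (281, 136), (302, 155), (301, 179), (309, 198), (313, 226), (299, 240), (299, 268), (273, 284)]),
  (false, [3, 2, 1, 4, 0, 5, 6, 7],
   [(164, 156), (174, 150), (182, 146), (195, 143), (207, 142), (220, 148), (230, 153), (237, 158), (247, 169), (254, 178), (256, 192), (256, 203), (255, 212), (252, 226), (247, 236)],
   [(174, 161), (181, 155), (192, 157), (202, 152), (209, 156), (220, 159), (229, 162), (234, 172), (242, 179), (243, 186), (246, 198), (248, 207), (242, 215), (240, 227), (234, 230)]),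
  (false, [2, 3, 1, 4, 0, 5, 6, 7],
   [(171, 167), (180, 162), (187, 159), (197, 157), (205, 158), (213, 161), (223, 165), (229, 169), (235, 178), (239, 185), (242, 194), (243, 203), (242, 210), (238, 221), (234, 227)],
   [(181, 171), (186, 166), (193, 168), (201, 164), (208, 167), (214, 170), (222, 172), (225, 180), (231, 184), (234, 191), (233, 199), (236, 206), (232, 212), (230, 220), (226, 224)]),
  (false, [2, 1, 3, 4, 0, 5, 6, 7],
   [(160, 153), (170, 146), (181, 139), (195, 138), (207, 140), (220, 144), (232, 149), (241, 154), (251, 169), (257, 179), (260, 191), (262, 203), (260, 215), (256, 231), (250, 239)],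
   [(172, 158), (179, 151), (191, 154), (201, 148), (210, 152), (222, 156), (230, 161), (237, 170), (245, 177), (247, 187), (250, 198), (251, 210), (246, 216), (244, 229), (237, 235)]),
  (false, [1, 2, 3, 4, 0, 5, 6, 7],
   [(154, 146), (164, 138), (178, 129), (195, 130), (207, 132), (222, 136), (236, 142), (247, 148), (259, 166), (264, 177), (268, 190), (272, 204), (269, 219), (264, 236), (257, 245)],
   [(168, 152), (175, 144), (190, 147), (200, 141), (211, 145), (226, 150), (233, 157), (242, 165), (252, 175), (253, 186), (258, 198), (258, 213), (252, 218), (252, 234), (242, 241)])]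

def tab7 : List Dat :=
  [(true, [3, 2, 1, 0, 4, 5, 6, 7],
   [(155, 149), (170, 138), (181, 136), (194, 134), (207, 133), (223, 139), (236, 144), (245, 154), (254, 165), (261, 177), (268, 190), (266, 206), (264, 218), (260, 231), (254, 244)],
   [(168, 154), (179, 148), (190, 147), (201, 146), (214, 146), (221, 155), (234, 156), (241, 167), (248, 178), (252, 184), (253, 201), (255, 208), (251, 220), (247, 232), (238, 238)]),
  (true, [2, 3, 1, 0, 4, 5, 6, 7],
   [(151, 144), (168, 132), (179, 129), (193, 127), (209, 128), (225, 133), (240, 139), (249, 149), (259, 163), (268, 176), (274, 189), (272, 207), (270, 220), (266, 236), (259, 248)],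
   [(166, 150), (177, 142), (189, 143), (202, 140), (215, 141), (223, 151), (238, 152), (245, 165), (252, 175), (258, 184), (257, 201), (261, 210), (256, 222), (250, 235), (243, 243)]),
  (true, [2, 1, 3, 0, 4, 5, 6, 7],
   [(161, 156), (174, 147), (183, 143), (194, 142), (208, 145), (219, 148), (231, 152), (239, 160), (247, 172), (254, 183), (258, 192), (257, 205), (256, 217), (253, 230), (246, 238)],
   [(173, 160), (182, 155), (191, 155), (201, 153), (212, 154), (218, 161), (230, 164), (236, 173), (240, 180), (247, 189), (245, 201), (248, 209), (245, 218), (239, 227), (235, 235)]),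
  (true, [1, 2, 3, 0, 4, 5, 6, 7],
   [(151, 145), (168, 133), (178, 127), (194, 129), (209, 131), (223, 135), (239, 140), (248, 150), (259, 167), (266, 179), (272, 190), (271, 207), (270, 223), (265, 238), (257, 248)],
   [(167, 150), (177, 143), (189, 144), (201, 141), (215, 142), (222, 152), (238, 156), (243, 165), (251, 177), (258, 186), (255, 202), (261, 213), (254, 221), (250, 236), (243, 244)]),
  (false, [3, 2, 1, 0, 4, 5, 6, 7],
   [(163, 154), (173, 147), (182, 145), (195, 143), (207, 142), (220, 148), (230, 154), (238, 160), (248, 172), (254, 180), (257, 194), (257, 207), (256, 215), (253, 229), (247, 238)],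
   [(173, 160), (181, 153), (192, 157), (201, 151), (210, 156), (220, 161), (229, 162), (235, 174), (242, 181), (244, 188), (247, 201), (248, 209), (243, 217), (241, 230), (234, 232)]),
  (false, [2, 3, 1, 0, 4, 5, 6, 7],
   [(169, 161), (178, 155), (185, 153), (197, 151), (206, 152), (217, 156), (226, 161), (232, 166), (241, 177), (245, 184), (248, 195), (248, 206), (247, 213), (244, 226), (239, 232)],
   [(178, 166), (184, 160), (194, 164), (201, 158), (209, 163), (217, 167), (225, 168), (229, 179), (236, 183), (237, 191), (239, 201), (241, 208), (235, 215), (235, 225), (228, 228)]),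
  (false, [2, 1, 3, 0, 4, 5, 6, 7],
   [(171, 164), (180, 158), (186, 155), (197, 154), (206, 156), (216, 159), (225, 163), (230, 168), (238, 179), (243, 186), (245, 195), (245, 205), (244, 213), (241, 225), (237, 230)],
   [(180, 168), (185, 163), (194, 166), (202, 161), (208, 165), (216, 169), (224, 171), (227, 180), (234, 184), (235, 192), (236, 201), (239, 208), (233, 214), (232, 223), (227, 227)]),
  (false, [1, 2, 3, 0, 4, 5, 6, 7],
   [(155, 145), (167, 136), (178, 129), (197, 132), (208, 134), (222, 138), (236, 144), (247, 152), (258, 171), (263, 180), (267, 193), (269, 208), (269, 223), (261, 239), (255, 246)],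
   [(169, 151), (178, 144), (189, 148), (202, 141), (212, 147), (224, 153), (236, 159), (239, 168), (252, 178), (253, 189), (255, 202), (258, 215), (250, 220), (250, 237), (241, 242)]),
  (false, [2, 1, 0, 3, 4, 5, 6, 7],
   [(140, 127), (159, 112), (174, 109), (194, 108), (215, 113), (230, 118), (252, 126), (263, 140), (277, 160), (287, 176), (290, 191), (293, 214), (289, 231), (283, 252), (272, 263)],
   [(162, 135), (170, 126), (188, 129), (204, 124), (218, 128), (233, 141), (248, 143), (257, 161), (266, 171), (275, 186), (271, 206), (278, 217), (269, 232), (262, 247), (257, 258)]),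
  (false, [1, 2, 0, 3, 4, 5, 6, 7],
   [(150, 140), (167, 127), (179, 123), (196, 126), (210, 129), (225, 133), (243, 139), (251, 151), (263, 170), (269, 181), (275, 193), (276, 212), (272, 228), (267, 244), (259, 252)],
   [(168, 146), (175, 139), (191, 142), (202, 137), (216, 141), (226, 152), (239, 155), (246, 167), (255, 178), (260, 189), (258, 206), (264, 216), (255, 225), (253, 241), (244, 248)]),
  (false, [1, 0, 2, 3, 4, 5, 6, 7],
   [(114, 92), (136, 71), (165, 70), (197, 72), (216, 74), (242, 85), (272, 98), (294, 118), (311, 150), (318, 166), (328, 193), (336, 227), (329, 248), (314, 278), (302, 292)],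
   [(144, 105), (158, 91), (182, 102), (204, 88), (226, 101), (250, 119), (265, 119), (279, 148), (299, 164), (302, 182), (306, 214), (307, 228), (297, 246), (295, 276), (276, 281)]),
  (false, [0, 1, 2, 3, 4, 5, 6, 7],
   [(113, 92), (135, 69), (166, 70), (197, 72), (216, 74), (240, 83), (272, 97), (295, 119), (310, 149), (317, 166), (327, 191), (337, 228), (329, 249), (313, 277), (301, 292)],
   [(145, 106), (158, 91), (181, 100), (204, 89), (226, 99), (250, 120), (264, 118), (279, 147), (298, 164), (303, 182), (305, 214), (306, 227), (298, 247), (294, 275), (277, 283)]),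
  (false, [2, 1, 0, 3, 4, 5, 6, 7],
   [(131, 117), (154, 99), (171, 96), (193, 95), (217, 101), (234, 106), (259, 115), (272, 132), (287, 154), (298, 173), (303, 189), (305, 216), (301, 236), (294, 259), (281, 272)],
   [(156, 126), (167, 116), (186, 118), (204, 114), (222, 117), (236, 133), (255, 135), (265, 155), (274, 167), (286, 184), (280, 207), (288, 219), (279, 237), (270, 253), (264, 267)]),
  (false, [1, 2, 0, 3, 4, 5, 6, 7],
   [(135, 122), (157, 105), (173, 100), (195, 103), (214, 107), (233, 112), (256, 120), (268, 136), (282, 159), (291, 175), (298, 190), (299, 215), (295, 236), (287, 256), (277, 268)],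
   [(158, 130), (169, 121), (187, 123), (204, 119), (221, 122), (234, 137), (252, 141), (260, 156), (272, 171), (279, 185), (276, 207), (283, 220), (273, 233), (268, 252), (258, 263)]),
  (false, [1, 0, 2, 3, 4, 5, 6, 7],
   [(132, 118), (153, 99), (173, 97), (197, 100), (214, 103), (232, 108), (259, 117), (272, 135), (286, 159), (293, 173), (300, 190), (306, 218), (299, 238), (289, 259), (279, 270)],
   [(159, 127), (166, 117), (187, 121), (204, 114), (221, 120), (238, 136), (252, 137), (262, 156), (276, 170), (282, 185), (279, 209), (286, 220), (275, 235), (272, 256), (261, 265)]),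
  (false, [0, 1, 2, 3, 4, 5, 6, 7],
   [(129, 116), (150, 95), (173, 96), (197, 98), (214, 100), (231, 105), (261, 115), (275, 135), (288, 157), (295, 172), (302, 189), (311, 220), (302, 239), (291, 259), (281, 272)],
   [(159, 126), (164, 115), (186, 118), (204, 113), (221, 117), (240, 136), (252, 134), (264, 155), (278, 170), (285, 184), (281, 210), (288, 219), (278, 237), (274, 257), (264, 267)])]

theorem tab0_ok : chkAll 0 tab0 = true := by decide +kernel

theorem tab1_ok : chkAll 16 tab1 = true := by decide +kernel

theorem tab2_ok : chkAll 32 tab2 = true := by decide +kernel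

theorem tab3_ok : chkAll 48 tab3 = true := by decide +kernel

theorem tab4_ok : chkAll 64 tab4 = true := by decide +kernel

theorem tab5_ok : chkAll 80 tab5 = true := by decide +kernel

theorem tab6_ok : chkAll 96 tab6 = true := by decide +kernel

theorem tab7_ok : chkAll 112 tab7 = true := by decide +kernel

/-! ### Correctness of the checker -/

def toC (p : Pt) : ℂ := ⟨(p.1 : ℝ) - 200, (p.2 : ℝ) - 200⟩

theorem cross_eq (u v : ℂ) : cross u v = u.re * v.im - u.im * v.re := by
  simp [cross, Complex.mul_im]; ring

theorem blt_iff (a b : ℕ) : Nat.blt a b = true ↔ a < b := by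
  simp [Nat.blt]

theorem ori_spec {a b c : Pt} (h : ori a b c = true) :
    0 < cross (toC b - toC a) (toC c - toC a) := by
  rw [ori, blt_iff] at h
  simp only [Nat.add_eq, Nat.mul_eq] at h
  have h' : ((a.2 * b.1 + b.2 * c.1 + c.2 * a.1 : ℕ) : ℝ) <
    ((a.1 * b.2 + b.1 * c.2 + c.1 * a.2 : ℕ) : ℝ) := by exact_mod_cast h
  push_cast at h'
  simp only [cross_eq, toC, Complex.sub_re, Complex.sub_im]
  linarith

theorem ori_spec' {a b c : Pt} (h : ori a b c = true) :
    0 < cross (toC b - toC a) (toC c - toC b) := by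
  have := ori_spec h
  simp only [cross_eq, Complex.sub_re, Complex.sub_im] at this ⊢
  linarith

theorem crs_spec {a b p q : Pt} (h : crs a b p q = true) :
    0 < cross (toC b - toC a) (toC q - toC p) := by
  rw [crs, blt_iff] at h
  have h' : ((b.1 * p.2 + a.1 * q.2 + b.2 * q.1 + a.2 * p.1 : ℕ) : ℝ) <
    ((b.1 * q.2 + a.1 * p.2 + b.2 * p.1 + a.2 * q.1 : ℕ) : ℝ) := by exact_mod_cast h
  push_cast at h'
  simp only [cross_eq, toC, Complex.sub_re, Complex.sub_im]
  linarith

def sg (b : Bool) : ℤ := bif b then 1 else -1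

theorem sgn_spec {e : Bool} {a b c : Pt} (h : sgn e a b c = true) :
    0 < ((sg e : ℤ) : ℝ) * cross (toC b - toC a) (toC c - toC b) := by
  cases e
  · have := ori_spec (show ori a c b = true from h)
    simp only [sg, cross_eq, Complex.sub_re, Complex.sub_im] at this ⊢
    push_cast [cond_false]
    linarith
  · have := ori_spec' (show ori a b c = true from h)
    simpa [sg] using this

theorem walk_spec {f : List Pt → Bool} : ∀ {n : ℕ} {l : List Pt}, walk f n l = true →
    ∀ j < n, f (l.drop j) = true
  | 0, _, _, j, hj => by omega
  | n + 1, l, h, j, hj => by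
    rw [walk, Bool.and_eq_true] at h
    cases j with
    | zero => simpa using h.1
    | succ j =>
      have := walk_spec h.2 j (by omega)
      simpa [List.drop_tail] using this

theorem at_drop (l : List Pt) (j k : ℕ) : at' (l.drop j) k = at' l (j + k) := by
  simp [at', List.getD_eq_getElem?_getD]

theorem at_dbl {l : List Pt} {h k : ℕ} (hl : l.length = h) (hk : k < 2 * h) :
    at' (l ++ l) k = at' l (k % h) := by
  simp only [at', List.getD_eq_getElem?_getD]
  by_cases hkh : k < h
  · rw [List.getElem?_append_left (by omega), Nat.mod_eq_of_lt hkh]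
  · rw [List.getElem?_append_right (by omega), hl, Nat.mod_eq_sub_mod (by omega),
      Nat.mod_eq_of_lt (by omega)]

theorem at_mem {l : List Pt} {k : ℕ} (hk : k < l.length) : at' l k ∈ l := by
  simp [at', List.getD_eq_getElem?_getD, hk]

theorem at_mem_take {l : List Pt} {j m k : ℕ} (hk : j + k < l.length) (hkm : k < m) :
    at' l (j + k) ∈ (l.drop j).take m := by
  rw [← at_drop]
  have : at' (l.drop j) k = at' ((l.drop j).take m) k := by
    simp [at', List.getD_eq_getElem?_getD, hkm]
  rw [this]
  apply at_mem
  simp; omega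

def Vf (h : ℕ) (l : List Pt) (j : ZMod h) : ℂ := toC (at' l j.val)

theorem Vf_cast {h : ℕ} (l : List Pt) (n : ℕ) :
    Vf h l (n : ZMod h) = toC (at' l (n % h)) := by
  rw [Vf, ZMod.val_natCast]

theorem conv_spec {h n m : ℕ} {l : List Pt} (hl : l.length = h) (hn : n ≤ h) (hm : m + 2 ≤ h)
    (hw : walk (convAt m) n (l ++ l) = true) (j k : ℕ) (hj : j < n) (hk : k < m) :
    0 < cross (Vf h l ((j + 1 : ℕ) : ZMod h) - Vf h l (j : ZMod h))
      (Vf h l ((j + 2 + k : ℕ) : ZMod h) - Vf h l (j : ZMod h)) := by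
  have h1 := walk_spec hw j hj
  rw [convAt, List.all_eq_true] at h1
  have h2 := h1 (at' ((l ++ l).drop j) (2 + k)) (at_mem_take (by simp; omega) hk)
  rw [at_drop, at_drop, at_drop, at_dbl hl (by omega), at_dbl hl (by omega),
    at_dbl hl (by omega)] at h2
  have h3 := ori_spec h2
  rw [Vf_cast, Vf_cast, Vf_cast]
  rw [← add_assoc] at h3
  exact h3

theorem conv_zmod {h n m : ℕ} [NeZero h] {l : List Pt} (hl : l.length = h) (hn : n ≤ h)
    (hm : m + 2 ≤ h)
    (hw : walk (convAt m) n (l ++ l) = true) (hd : ∀ j i : ZMod h, i ≠ j - 1 → i ≠ j →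
      (i - j - 1).val < m) (j i : ZMod h) (hj : (j - 1).val < n) (h1 : i ≠ j - 1) (h2 : i ≠ j) :
    0 < cross (Vf h l j - Vf h l (j - 1)) (Vf h l i - Vf h l (j - 1)) := by
  have := conv_spec hl hn hm hw (j - 1).val (i - j - 1).val hj (hd j i h1 h2)
  push_cast [ZMod.natCast_zmod_val] at this
  have e1 : j - 1 + 1 = j := by ring
  have e2 : j - 1 + 2 + (i - j - 1) = i := by ring
  rwa [e1, e2] at this

theorem hd8 : ∀ j i : ZMod 8, i ≠ j - 1 → i ≠ j → (i - j - 1).val < 6 := by decide +kernel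
theorem hd30 : ∀ j i : ZMod 30, i ≠ j - 1 → i ≠ j → (i - j - 1).val < 28 := by decide +kernel
theorem half30 : ∀ j : ZMod 30, j.val < 15 ∨ (j + 15).val < 15 := by decide +kernel
theorem low30 : ∀ i : ZMod 30, i ∉ ({1, 2, 3, 4, 5} : Finset (ZMod 30)) →
    (i - 6).val < 25 := by decide +kernel

theorem chkW_spec : ∀ {w l : List Pt}, chkW w l = true → ∀ j < w.length,
    (at' w j).1 + (at' l (j + 10)).1 = (at' l (j + 1)).1 + (at' l (j + 11)).1 ∧
    (at' w j).2 + (at' l (j + 10)).2 = (at' l (j + 1)).2 + (at' l (j + 11)).2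
  | [], _, _, j, hj => by simp at hj
  | a :: t, l, h, j, hj => by
    simp only [chkW, Bool.and_eq_true] at h
    cases j with
    | zero => simpa [at'] using h.1
    | succ j =>
      have := chkW_spec h.2 j (by simpa using hj)
      rw [← List.drop_one, at_drop, at_drop, at_drop] at this
      have e : at' (a :: t) (j + 1) = at' t j := by simp [at']
      rw [e, show j + 1 + 10 = 1 + (j + 10) by ring, show j + 1 + 1 = 1 + (j + 1) by ring,
        show j + 1 + 11 = 1 + (j + 11) by ring]
      exact this

theorem Vf_dbl {v : List Pt} (hl : v.length = 30) (j : ZMod 30) (k : ℕ) (hk : k ≤ 30) :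
    toC (at' (v ++ v) (j.val + k)) = Vf 30 v (j + k) := by
  rw [at_dbl hl (by have := ZMod.val_lt j; omega), ← Vf_cast]
  push_cast [ZMod.natCast_zmod_val]
  rfl

theorem cLt_of {a b : Pt} (h : Nat.blt a.2 b.2 = true) : cLt (toC a) (toC b) := by
  rw [blt_iff] at h
  left
  simp only [toC]
  have : (a.2 : ℝ) < b.2 := by exact_mod_cast h
  linarith

theorem cLt_not {a b : ℂ} (h : cLt a b) : ¬ cLt b a := by
  unfold cLt at *
  rintro (h' | ⟨h1', h2'⟩) <;> rcases h with h | ⟨h1, h2⟩ <;> linarith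

theorem cLt_ne {a b : ℂ} (h : cLt a b) : a ≠ b := by
  rintro rfl; exact cLt_not h h


theorem rel_spec {v : List Pt} (hl : v.length = 30) (h : walk relAt 30 (v ++ v) = true)
    (j : ZMod 30) :
    Vf 30 v j + Vf 30 v (j + 15) = 0 ∧
    Vf 30 v j + Vf 30 v (j + 10) + Vf 30 v (j + 20) = 0 ∧
    Vf 30 v j + Vf 30 v (j + 6) + Vf 30 v (j + 12) + Vf 30 v (j + 18) + Vf 30 v (j + 24) = 0 := by
  have h1 := walk_spec h j.val (ZMod.val_lt j)
  simp only [relAt, Bool.and_eq_true, Nat.beq_eq, at_drop] at h1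
  have e0 := Vf_dbl hl j 0 (by norm_num)
  have e6 := Vf_dbl hl j 6 (by norm_num)
  have e10 := Vf_dbl hl j 10 (by norm_num)
  have e12 := Vf_dbl hl j 12 (by norm_num)
  have e15 := Vf_dbl hl j 15 (by norm_num)
  have e18 := Vf_dbl hl j 18 (by norm_num)
  have e20 := Vf_dbl hl j 20 (by norm_num)
  have e24 := Vf_dbl hl j 24 (by norm_num)
  push_cast at e0 e6 e10 e12 e15 e18 e20 e24
  rw [add_zero] at e0
  rw [add_zero] at e0
  simp only [add_zero] at h1
  rw [← e0, ← e6, ← e10, ← e12, ← e15, ← e18, ← e20, ← e24]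
  obtain ⟨⟨⟨a, b⟩, c, d⟩, e, f⟩ := h1
  rify at a b c d e f
  refine ⟨?_, ?_, ?_⟩ <;> apply Complex.ext <;> simp only [toC, Complex.add_re, Complex.add_im,
    Complex.zero_re, Complex.zero_im] <;> linarith

theorem W_spec {v w : List Pt} (hl : v.length = 30) (hw : w.length = 30)
    (h : chkW w (v ++ v) = true) (j : ZMod 30) : WE8 (Vf 30 v) j = Vf 30 w j := by
  have h1 := chkW_spec h j.val (by rw [hw]; exact ZMod.val_lt j)
  have e1 := Vf_dbl hl j 1 (by norm_num)
  have e10 := Vf_dbl hl j 10 (by norm_num)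
  have e11 := Vf_dbl hl j 11 (by norm_num)
  push_cast at e1 e10 e11
  rw [WE8, zEdge, show j + 11 - 1 = j + 10 by ring, ← e1, ← e10, ← e11, Vf]
  obtain ⟨a, b⟩ := h1
  rify at a b
  apply Complex.ext <;> simp only [toC, Complex.add_re, Complex.add_im,
    Complex.sub_re, Complex.sub_im] <;> linarith

theorem diag_spec {v w : List Pt} (hl : v.length = 30) (hw : w.length = 30)
    (h : walk (diagAt w) 15 (v ++ v) = true) (j k : ZMod 30) (hj : j.val < 15) :
    0 < cross (Vf 30 v (j + 5) - Vf 30 v j) (Vf 30 w k - Vf 30 v j) := by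
  have h1 := walk_spec h j.val hj
  rw [diagAt, List.all_eq_true] at h1
  have h2 := ori_spec (h1 (at' w k.val) (at_mem (by rw [hw]; exact ZMod.val_lt k)))
  rw [at_drop, at_drop, Vf_dbl hl _ _ (by norm_num), Vf_dbl hl _ _ (by norm_num)] at h2
  push_cast at h2
  rwa [add_zero] at h2

theorem cross_neg (a b c : ℂ) : cross (-a - -b) (-c - -b) = cross (a - b) (c - b) := by
  simp only [cross_eq, Complex.sub_re, Complex.sub_im, Complex.neg_re, Complex.neg_im]
  ring

theorem stable_of {tt : Bool} {v w : List Pt} (h : chkV tt v w = true) :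
    IsStableE8Gon (Vf 30 v) := by
  simp only [chkV, Bool.and_eq_true, Nat.beq_eq] at h
  obtain ⟨⟨⟨⟨⟨⟨⟨hl, hw⟩, hc⟩, hd⟩, hr⟩, hW⟩, -⟩, -⟩ := h
  have R := rel_spec hl hr
  have N : ∀ j, Vf 30 v (j + 15) = -Vf 30 v j := fun j =>
    eq_neg_of_add_eq_zero_right (R j).1
  have WW := W_spec hl hw hW
  have NW : ∀ j, WE8 (Vf 30 v) (j + 15) = -WE8 (Vf 30 v) j := fun j => by
    simp only [WE8, zEdge]
    rw [show j + 15 + 1 = j + 1 + 15 by ring, show j + 15 + 11 - 1 = j + 11 - 1 + 15 by ring,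
      show j + 15 + 11 = j + 11 + 15 by ring, N, N, N]
    ring
  refine ⟨⟨N, fun j => ?_, fun j => ?_⟩, ?_, ?_⟩
  · have a := (R j).2.1
    have b := (R (j - 1)).2.1
    simp only [zEdge]
    rw [show j + 10 - 1 = j - 1 + 10 by ring, show j + 20 - 1 = j - 1 + 20 by ring]
    linear_combination a - b
  · have a := (R j).2.2
    have b := (R (j - 1)).2.2
    simp only [zEdge]
    rw [show j + 6 - 1 = j - 1 + 6 by ring, show j + 12 - 1 = j - 1 + 12 by ring,
      show j + 18 - 1 = j - 1 + 18 by ring, show j + 24 - 1 = j - 1 + 24 by ring]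
    linear_combination a - b
  · intro j i h1 h2
    rcases half30 (j - 1) with h3 | h3
    · exact conv_zmod hl (by norm_num) (by norm_num) hc hd30 j i h3 h1 h2
    · have e : j - 1 + 15 = j + 15 - 1 := by ring
      have := conv_zmod hl (by norm_num) (by norm_num) hc hd30 (j + 15) (i + 15)
        (by rwa [e] at h3) (by rw [← e]; simpa using h1) (by simpa using h2)
      rwa [← e, N, N, N, cross_neg] at this
  · intro k j
    push_cast
    rcases half30 j with h3 | h3
    · rw [WW]; exact diag_spec hl hw hd j k h3
    · have := diag_spec hl hw hd (j + 15) (k + 15) h3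
      rwa [← WW, NW, show j + 15 + 5 = j + 5 + 15 by ring, N, N, cross_neg] at this

theorem low_of {tt : Bool} {v w : List Pt} (h : chkV tt v w = true) (t : ZMod 30)
    (ht : t ∈ ({1, 2, 3, 4, 5} : Set (ZMod 30))) :
    (∀ k : ZMod 30, cLt (Vf 30 v t) (WE8 (Vf 30 v) k)) ∧
    (∀ i : ZMod 30, i ∉ ({1, 2, 3, 4, 5} : Set (ZMod 30)) → cLt (Vf 30 v t) (Vf 30 v i)) := by
  simp only [chkV, Bool.and_eq_true, Nat.beq_eq] at h
  obtain ⟨⟨⟨⟨⟨⟨⟨hl, hw⟩, hc⟩, hd⟩, hr⟩, hW⟩, hlow⟩, -⟩ := h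
  have WW := W_spec hl hw hW
  rw [List.all_eq_true] at hlow
  have hm : at' v t.val ∈ (v.drop 1).take 5 := by
    have : ∃ k, k < 5 ∧ t.val = 1 + k := by
      simp only [Set.mem_insert_iff, Set.mem_singleton_iff] at ht
      rcases ht with rfl | rfl | rfl | rfl | rfl
      · exact ⟨0, by decide⟩
      · exact ⟨1, by decide⟩
      · exact ⟨2, by decide⟩
      · exact ⟨3, by decide⟩
      · exact ⟨4, by decide⟩
    obtain ⟨k, hk, e⟩ := this
    rw [e]
    exact at_mem_take (by omega) hk
  have h1 := hlow _ hm
  rw [Bool.and_eq_true, lowAt, lowAt, List.all_eq_true, List.all_eq_true] at h1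
  refine ⟨fun k => ?_, fun i hi => ?_⟩
  · rw [WW]
    exact cLt_of (h1.1 _ (at_mem (by rw [hw]; exact ZMod.val_lt k)))
  · have hi' := low30 i (by simpa using hi)
    have := cLt_of (h1.2 _ (at_mem_take (k := (i - 6).val) (by simp; omega) hi'))
    rw [at_dbl hl (by omega), ← Vf_cast] at this
    push_cast [ZMod.natCast_zmod_val] at this
    rwa [show (6 : ZMod 30) + (i - 6) = i by ring] at this

theorem octo_spec {b1 b2 b3 b4 b5 b6 b7 tt : Bool} {ps : List ℕ} {v0 w2 : Pt} {o : List Pt}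
    (h : chkO b1 b2 b3 b4 b5 b6 b7 tt ps v0 w2 o = true) :
    ∃ P : Fin 8 → ℂ,
      (∀ i j : Fin 8, i < j → cLt (P i) (P j)) ∧
      Set.range P = Set.range (Vf 8 o) ∧ PosConvex (Vf 8 o) ∧ o.length = 8 ∧
      0 < ((sg b1 : ℤ) : ℝ) * cross (P 1 - P 0) (P 2 - P 1) ∧
      0 < ((sg b2 : ℤ) : ℝ) * cross (P 2 - P 1) (P 3 - P 2) ∧
      0 < ((sg b3 : ℤ) : ℝ) * cross (bif tt then toC v0 - toC w2 else toC w2 - toC v0)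
        (P 3 - P 2) ∧
      0 < ((sg b4 : ℤ) : ℝ) * cross (P 3 - P 2) (P 4 - P 3) ∧
      0 < ((sg b5 : ℤ) : ℝ) * cross (P 4 - P 3) (P 5 - P 4) ∧
      0 < ((sg b6 : ℤ) : ℝ) * cross (P 5 - P 4) (P 6 - P 5) ∧
      0 < ((sg b7 : ℤ) : ℝ) * cross (P 6 - P 5) (P 7 - P 6) := by
  simp only [chkO, Bool.and_eq_true, Nat.beq_eq] at h
  obtain ⟨⟨⟨⟨⟨⟨hl, hps⟩, hlt⟩, hconv⟩, hmono⟩, hs⟩, h3⟩ := h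
  obtain ⟨⟨⟨⟨⟨⟨m0, m1⟩, m2⟩, m3⟩, m4⟩, m5⟩, m6⟩ := hmono
  obtain ⟨⟨⟨⟨⟨s1, s2⟩, s4⟩, s5⟩, s6⟩, s7⟩ := hs
  rw [List.all_eq_true] at hlt
  have mono : StrictMono (fun i : Fin 8 => (pp o ps i.val).2) := by
    rw [Fin.strictMono_iff_lt_succ]
    simp only [blt_iff] at m0 m1 m2 m3 m4 m5 m6
    intro i
    fin_cases i
    exacts [m0, m1, m2, m3, m4, m5, m6]
  let g : Fin 8 → Fin 8 := fun i => ⟨ps.getD i.val 0, by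
    have := hlt (ps.getD i.val 0) (by
      rw [List.getD_eq_getElem _ _ (by rw [hps]; exact i.2)]; exact List.getElem_mem _)
    rwa [blt_iff] at this⟩
  have hg : Function.Injective g := by
    intro i j hij
    apply mono.injective
    have : ps.getD i.val 0 = ps.getD j.val 0 := congrArg Fin.val hij
    simp only [pp, this]
  have hgs : Function.Surjective g := Finite.surjective_of_injective hg
  refine ⟨fun i => toC (pp o ps i.val), fun i j hij => ?_, ?_, ?_, hl, sgn_spec s1, sgn_spec s2, ?_,
    sgn_spec s4, sgn_spec s5, sgn_spec s6, sgn_spec s7⟩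
  · apply cLt_of
    rw [blt_iff]
    exact mono hij
  · exact hgs.range_comp (Vf 8 o)
  · intro j i h1 h2
    exact conv_zmod hl le_rfl (by norm_num) hconv hd8 j i (ZMod.val_lt _) h1 h2
  · show 0 < ((sg b3 : ℤ) : ℝ) * cross (bif tt then toC v0 - toC w2 else toC w2 - toC v0)
        (toC (pp o ps 3) - toC (pp o ps 2))
    cases b3 <;> cases tt <;>
      simp only [Bool.xor_false, Bool.xor_true, Bool.not_true, Bool.not_false, cond_true,
        cond_false] at h3 <;>
      have := crs_spec h3 <;>
      simp only [sg, cross_eq, Complex.sub_re, Complex.sub_im, cond_true, cond_false] at this ⊢ <;>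
      push_cast <;> linarith

theorem range8 {o : List Pt} {a b c d e f g h : Pt} (ho : o = [a, b, c, d, e, f, g, h]) :
    Set.range (Vf 8 o) = ({toC a, toC b, toC c, toC d, toC e} : Set ℂ) ∪
      {toC f, toC g, toC h} := by
  subst ho
  ext z
  constructor
  · rintro ⟨j, rfl⟩
    change Fin 8 at j
    fin_cases j <;> simp [Vf, at', ZMod.val]
  · simp only [Set.mem_union, Set.mem_insert_iff, Set.mem_singleton_iff]
    rintro ((rfl | rfl | rfl | rfl | rfl) | (rfl | rfl | rfl))
    exacts [⟨0, rfl⟩, ⟨1, rfl⟩, ⟨2, rfl⟩, ⟨3, rfl⟩, ⟨4, rfl⟩, ⟨5, rfl⟩, ⟨6, rfl⟩, ⟨7, rfl⟩]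

theorem at_full {l : List Pt} (hl : (full l).length = 30) {k : ℕ} (hk : k < 15) :
    at' l k = at' (full l) k := by
  simp only [full, List.length_append, List.length_map] at hl
  simp only [at', full, List.getD_eq_getElem?_getD]
  rw [List.getElem?_append_left (by omega)]

theorem chkAll_spec : ∀ {n : ℕ} {l : List Dat}, chkAll n l = true → ∀ k, n ≤ k → k < n + l.length →
    ∃ d, chk (k.testBit 0) (k.testBit 1) (k.testBit 2) (k.testBit 3) (k.testBit 4)
      (k.testBit 5) (k.testBit 6) d = true
  | n, [], _, k, h1, h2 => by simp at h2; omega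
  | n, a :: t, h, k, h1, h2 => by
    rw [chkAll, Bool.and_eq_true] at h
    rcases Nat.eq_or_lt_of_le h1 with rfl | h1
    · exact ⟨a, h.1⟩
    · exact chkAll_spec h.2 k h1 (by simp at h2; omega)

theorem exists_chk_nat (k : ℕ) (hk : k < 128) :
    ∃ d, chk (k.testBit 0) (k.testBit 1) (k.testBit 2) (k.testBit 3) (k.testBit 4)
      (k.testBit 5) (k.testBit 6) d = true := by
  by_cases h1 : k < 16
  · exact chkAll_spec tab0_ok k (by omega) h1
  by_cases h2 : k < 32
  · exact chkAll_spec tab1_ok k (by omega) h2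
  by_cases h3 : k < 48
  · exact chkAll_spec tab2_ok k (by omega) h3
  by_cases h4 : k < 64
  · exact chkAll_spec tab3_ok k (by omega) h4
  by_cases h5 : k < 80
  · exact chkAll_spec tab4_ok k (by omega) h5
  by_cases h6 : k < 96
  · exact chkAll_spec tab5_ok k (by omega) h6
  by_cases h7 : k < 112
  · exact chkAll_spec tab6_ok k (by omega) h7
  · exact chkAll_spec tab7_ok k (by omega) hk

theorem bits (b1 b2 b3 b4 b5 b6 b7 : Bool) : ∃ k : ℕ, k < 128 ∧ k.testBit 0 = b1 ∧
    k.testBit 1 = b2 ∧ k.testBit 2 = b3 ∧ k.testBit 3 = b4 ∧ k.testBit 4 = b5 ∧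
    k.testBit 5 = b6 ∧ k.testBit 6 = b7 := by
  refine ⟨b1.toNat + 2 * b2.toNat + 4 * b3.toNat + 8 * b4.toNat + 16 * b5.toNat + 32 * b6.toNat +
    64 * b7.toNat, ?_⟩
  cases b1 <;> cases b2 <;> cases b3 <;> cases b4 <;> cases b5 <;> cases b6 <;> cases b7 <;>
    decide

theorem exists_chk (b1 b2 b3 b4 b5 b6 b7 : Bool) : ∃ d, chk b1 b2 b3 b4 b5 b6 b7 d = true := by
  obtain ⟨k, hk, rfl, rfl, rfl, rfl, rfl, rfl, rfl⟩ := bits b1 b2 b3 b4 b5 b6 b7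
  exact exists_chk_nat k hk

theorem exists_sg {e : ℤ} (h : e = 1 ∨ e = -1) : ∃ b, e = sg b := by
  rcases h with rfl | rfl
  · exact ⟨true, rfl⟩
  · exact ⟨false, rfl⟩

theorem set_swap (a b c : ℂ) : ({a, b, c} : Set ℂ) = {c, b, a} := by
  ext z
  simp only [Set.mem_insert_iff, Set.mem_singleton_iff]
  tauto

/-- Geometric form of Proposition 5.4 for `E₈`: every sign function on the seven edges
`(1,2), (2,4), (3,4), (4,5), (5,6), (6,7), (7,8)` of the `E₈` diagram is realized by a
stable 30-gon of type `E8` (after cyclic relabeling). -/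
theorem typeE8_realization (e12 e24 e34 e45 e56 e67 e78 : ℤ)
    (h12 : e12 = 1 ∨ e12 = -1) (h24 : e24 = 1 ∨ e24 = -1) (h34 : e34 = 1 ∨ e34 = -1)
    (h45 : e45 = 1 ∨ e45 = -1) (h56 : e56 = 1 ∨ e56 = -1) (h67 : e67 = 1 ∨ e67 = -1)
    (h78 : e78 = 1 ∨ e78 = -1) :
    ∃ V : ZMod 30 → ℂ, IsStableE8Gon V ∧
      (∀ t : ZMod 30, t ∈ ({1, 2, 3, 4, 5} : Set (ZMod 30)) →
        (∀ k : ZMod 30, cLt (V t) (WE8 V k)) ∧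
        (∀ i : ZMod 30, i ∉ ({1, 2, 3, 4, 5} : Set (ZMod 30)) → cLt (V t) (V i))) ∧
      WE8 V 1 ≠ WE8 V 4 ∧
      ∃ T : Set ℂ,
        ((cLt (WE8 V 1) (WE8 V 4) ∧ T = {V 0, WE8 V 1, WE8 V 3}) ∨
         (cLt (WE8 V 4) (WE8 V 1) ∧ T = {WE8 V 2, WE8 V 4, V 6})) ∧
        ∃ P : Fin 8 → ℂ,
          (∀ i j : Fin 8, i < j → cLt (P i) (P j)) ∧
          Set.range P = ({V 1, V 2, V 3, V 4, V 5} : Set ℂ) ∪ T ∧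
          (∃ U : ZMod 8 → ℂ, PosConvex U ∧ Set.range U = Set.range P) ∧
          ∃ s3 : ℂ,
            ((cLt (V 0) (WE8 V 2) ∧ s3 = WE8 V 2 - V 0) ∨
             (¬ cLt (V 0) (WE8 V 2) ∧ s3 = V 0 - WE8 V 2)) ∧
            0 < (e12 : ℝ) * cross (P 1 - P 0) (P 2 - P 1) ∧
            0 < (e24 : ℝ) * cross (P 2 - P 1) (P 3 - P 2) ∧
            0 < (e34 : ℝ) * cross s3 (P 3 - P 2) ∧
            0 < (e45 : ℝ) * cross (P 3 - P 2) (P 4 - P 3) ∧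
            0 < (e56 : ℝ) * cross (P 4 - P 3) (P 5 - P 4) ∧
            0 < (e67 : ℝ) * cross (P 5 - P 4) (P 6 - P 5) ∧
            0 < (e78 : ℝ) * cross (P 6 - P 5) (P 7 - P 6) := by
  obtain ⟨b1, rfl⟩ := exists_sg h12
  obtain ⟨b2, rfl⟩ := exists_sg h24
  obtain ⟨b3, rfl⟩ := exists_sg h34
  obtain ⟨b4, rfl⟩ := exists_sg h45
  obtain ⟨b5, rfl⟩ := exists_sg h56
  obtain ⟨b6, rfl⟩ := exists_sg h67
  obtain ⟨b7, rfl⟩ := exists_sg h78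
  obtain ⟨⟨tt, ps, v', w'⟩, hd⟩ := exists_chk b1 b2 b3 b4 b5 b6 b7
  simp only [chk, Bool.and_eq_true] at hd
  obtain ⟨hV, hO⟩ := hd
  have hV' := hV
  simp only [chkV, Bool.and_eq_true, Nat.beq_eq] at hV'
  obtain ⟨⟨⟨⟨⟨⟨⟨hl, hw⟩, -⟩, -⟩, -⟩, hW⟩, -⟩, htt⟩ := hV'
  have WW := W_spec hl hw hW
  obtain ⟨P, hP, hr, hc, -, q1, q2, q3, q4, q5, q6, q7⟩ := octo_spec hO
  rw [octo, at_full hl (k := 0) (by norm_num), at_full hl (k := 1) (by norm_num),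
    at_full hl (k := 2) (by norm_num), at_full hl (k := 3) (by norm_num),
    at_full hl (k := 4) (by norm_num), at_full hl (k := 5) (by norm_num),
    at_full hl (k := 6) (by norm_num), at_full hw (k := 1) (by norm_num),
    at_full hw (k := 2) (by norm_num), at_full hw (k := 3) (by norm_num),
    at_full hw (k := 4) (by norm_num)] at hr hc
  rw [at_full hl (k := 0) (by norm_num), at_full hw (k := 2) (by norm_num)] at q3
  refine ⟨Vf 30 (full v'), stable_of hV, low_of hV, ?_⟩
  rw [WW, WW, WW, WW]
  cases tt
  · simp only [cond_false, Bool.and_eq_true, List.cons_append, List.nil_append] at htt hr hc q3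
    have l1 : cLt (Vf 30 (full w') 1) (Vf 30 (full w') 4) := cLt_of htt.1
    have l2 : cLt (Vf 30 (full v') 0) (Vf 30 (full w') 2) := cLt_of htt.2
    refine ⟨cLt_ne l1, _, Or.inl ⟨l1, rfl⟩, P, hP, ?_, ⟨_, hc, hr.symm⟩, _, Or.inl ⟨l2, rfl⟩,
      q1, q2, q3, q4, q5, q6, q7⟩
    rw [hr, range8 rfl, set_swap (toC (at' _ _)) (toC (at' (full w') _))]
    rfl
  · simp only [cond_true, Bool.and_eq_true, List.cons_append, List.nil_append] at htt hr hc q3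
    have l1 : cLt (Vf 30 (full w') 4) (Vf 30 (full w') 1) := cLt_of htt.1
    have l2 : cLt (Vf 30 (full w') 2) (Vf 30 (full v') 0) := cLt_of htt.2
    refine ⟨(cLt_ne l1).symm, _, Or.inr ⟨l1, rfl⟩, P, hP, ?_, ⟨_, hc, hr.symm⟩, _,
      Or.inr ⟨cLt_not l2, rfl⟩, q1, q2, q3, q4, q5, q6, q7⟩
    rw [hr, range8 rfl, set_swap (toC (at' _ _)) (toC (at' (full w') _))]
    rfl
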